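/- (Mordell) If there exists a positive integer h₀ and infinitely many squarefree integers d < 0 such that the class number of the imaginary quadratic field ℚ(√d) equals h₀, then the Riemann hypothesis holds: every zero ρ of the Riemann zeta function ζ with 0 < Re ρ < 1 satisfies Re ρ = 1/2. -/

import Mathlib

open Complex


namespace Mordell
open MeasureTheory

lemma row_compare (f f' : ℝ → ℂ) (hd : ∀ t, HasDerivAt f (f' t) t)
    (hf : Integrable f) (hf' : Integrable f') :
    Summable (fun m : ℤ => ‖f m‖) ∧ ‖(∑' m : ℤ, f m) - ∫ t, f t‖ ≤ ∫ t, ‖f' t‖ := by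
  have h1 := hf.hasSum_intervalIntegral 0
  have h1n := hf.norm.hasSum_intervalIntegral 0
  have h2 := hf'.norm.hasSum_intervalIntegral 0
  simp only [zero_add] at h1 h2 h1n
  have key : ∀ m : ℤ, ‖f m - ∫ x in (m:ℝ)..m + 1, f x‖ ≤ ∫ x in (m:ℝ)..m+1, ‖f' x‖ := by
    intro m
    have hle : (m:ℝ) ≤ m + 1 := by linarith
    have e : f m - ∫ x in (m:ℝ)..m + 1, f x = ∫ x in (m:ℝ)..m+1, (f m - f x) := by
      rw [intervalIntegral.integral_sub]
      · simp
      · simp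
      · exact hf.intervalIntegrable
    rw [e]
    have := intervalIntegral.norm_integral_le_of_norm_le_const (a := (m:ℝ)) (b := m+1)
      (C := ∫ x in (m:ℝ)..m+1, ‖f' x‖) (f := fun x => f m - f x) ?_
    · simpa using this
    · intro t ht
      rw [Set.uIoc_of_le hle] at ht
      have e2 := intervalIntegral.integral_eq_sub_of_hasDerivAt (a := (m:ℝ)) (b := t)
        (fun x _ => hd x) hf'.intervalIntegrable
      rw [norm_sub_rev, ← e2]
      refine (intervalIntegral.norm_integral_le_integral_norm ht.1.le).trans ?_
      refine intervalIntegral.integral_mono_interval le_rfl ht.1.le ht.2 ?_ hf'.norm.intervalIntegrable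
      exact Filter.Eventually.of_forall fun x => norm_nonneg _
  have hs : Summable (fun m : ℤ => ‖f m‖) := by
    refine Summable.of_nonneg_of_le (fun _ => norm_nonneg _) (fun m => ?_) (h2.summable.add h1n.summable)
    have := norm_sub_norm_le (f m) (∫ x in (m:ℝ)..m + 1, f x)
    have h3 := key m
    have h4 : ‖∫ x in (m:ℝ)..m + 1, f x‖ ≤ ∫ x in (m:ℝ)..m + 1, ‖f x‖ :=
      intervalIntegral.norm_integral_le_integral_norm (by linarith)
    linarith
  refine ⟨hs, ?_⟩
  have h5 := hs.of_norm.hasSum.sub h1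
  rw [← h5.tsum_eq, ← h2.tsum_eq]
  have hsn : Summable fun m : ℤ => ‖f m - ∫ x in (m:ℝ)..m + 1, f x‖ :=
    Summable.of_nonneg_of_le (fun _ => norm_nonneg _) key h2.summable
  refine (norm_tsum_le_tsum_norm hsn).trans ?_
  exact hsn.tsum_le_tsum key h2.summable

/-- basic kernel -/
noncomputable def gk (s : ℂ) (t : ℝ) : ℂ := ((1 + t ^ 2 : ℝ) : ℂ) ^ (-s)

noncomputable def gk' (s : ℂ) (t : ℝ) : ℂ := (-s) * ((1 + t ^ 2 : ℝ) : ℂ) ^ (-s - 1) * ((2 * t : ℝ) : ℂ)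

noncomputable def bR (σ : ℝ) : ℝ := ∫ t : ℝ, (1 + t ^ 2) ^ (-σ)

noncomputable def BC (s : ℂ) : ℂ := ∫ t : ℝ, gk s t

lemma one_add_sq_pos (t : ℝ) : 0 < 1 + t ^ 2 := by positivity

lemma gk_deriv (s : ℂ) (t : ℝ) : HasDerivAt (gk s) (gk' s t) t := by
  have h : HasDerivAt (fun t : ℝ => ((1 + t ^ 2 : ℝ) : ℂ)) ((2 * t : ℝ) : ℂ) t := by
    have := ((hasDerivAt_pow 2 t).const_add 1).ofReal_comp
    simpa using this
  have h2 := (hasDerivAt_id ((1 + t ^ 2 : ℝ) : ℂ)).cpow_const (c := -s)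
    (Complex.ofReal_mem_slitPlane.2 (one_add_sq_pos t))
  have := h2.comp_of_eq t h rfl
  have e : gk s = fun x : ℝ => ((1 + x ^ 2 : ℝ) : ℂ) ^ (-s) := rfl
  rw [e]
  simpa [gk', Function.comp_def] using this

lemma gk_norm (s : ℂ) (t : ℝ) : ‖gk s t‖ = (1 + t ^ 2) ^ (-s.re) := by
  rw [gk, Complex.norm_cpow_eq_rpow_re_of_pos (one_add_sq_pos t)]; simp

lemma gk'_norm_le (s : ℂ) (t : ℝ) : ‖gk' s t‖ ≤ ‖s‖ * (1 + t ^ 2) ^ (-s.re) := by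
  have hp := one_add_sq_pos t
  rw [gk', norm_mul, norm_mul, norm_neg, Complex.norm_cpow_eq_rpow_re_of_pos hp, Complex.norm_real,
    mul_assoc]
  gcongr
  have : (-s - 1).re = -s.re - 1 := by simp
  rw [this, Real.rpow_sub_one hp.ne', div_mul_eq_mul_div, div_le_iff₀ hp]
  gcongr
  rw [Real.norm_eq_abs, abs_le]
  constructor <;> nlinarith [sq_nonneg (t-1), sq_nonneg (t+1)]

lemma b_integrable {σ : ℝ} (h : 1 / 2 < σ) : Integrable fun t : ℝ => (1 + t ^ 2) ^ (-σ) := by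
  have := integrable_rpow_neg_one_add_norm_sq (E := ℝ) (μ := volume) (r := 2 * σ) (by simp; linarith)
  refine this.congr (Filter.Eventually.of_forall fun t => ?_)
  simp only [Real.norm_eq_abs, sq_abs]
  congr 1; ring

lemma gk_cont (s : ℂ) : Continuous (gk s) :=
  continuous_iff_continuousAt.2 fun t => (gk_deriv s t).continuousAt

lemma gk'_cont (s : ℂ) : Continuous (gk' s) := by
  have : gk' s = fun t => (-s) * gk (s+1) t * ((2 * t : ℝ) : ℂ) := by
    ext t; simp only [gk', gk]; congr 3; ring
  rw [this]
  have := gk_cont (s+1)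
  fun_prop

lemma gk_int {s : ℂ} (h : 1 / 2 < s.re) : Integrable (gk s) :=
  (b_integrable h).mono' (gk_cont s).aestronglyMeasurable
    (Filter.Eventually.of_forall fun t => (gk_norm s t).le)

lemma gk'_int {s : ℂ} (h : 1 / 2 < s.re) : Integrable (gk' s) :=
  ((b_integrable h).const_mul ‖s‖).mono' (gk'_cont s).aestronglyMeasurable
    (Filter.Eventually.of_forall fun t => (gk'_norm_le s t))

lemma gk'_int_le {s : ℂ} (h : 1 / 2 < s.re) : ∫ t, ‖gk' s t‖ ≤ ‖s‖ * bR s.re := by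
  rw [bR, ← integral_const_mul]
  exact integral_mono (gk'_int h).norm ((b_integrable h).const_mul _) (gk'_norm_le s)

lemma bR_nonneg (σ : ℝ) : 0 ≤ bR σ := integral_nonneg fun t => by
  have := one_add_sq_pos t
  positivity

lemma bR_anti {σ σ' : ℝ} (h : 1 / 2 < σ) (h' : σ ≤ σ') : bR σ' ≤ bR σ :=
  integral_mono (b_integrable (h.trans_le h')) (b_integrable h) fun t =>
    Real.rpow_le_rpow_of_exponent_le (by nlinarith) (by linarith)

lemma BC_diff {s : ℂ} (h : 1 / 2 < s.re) : DifferentiableAt ℂ BC s := by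
  set ε := (s.re - 1 / 2) / 3 with hε
  have hε0 : 0 < ε := by rw [hε]; linarith
  have hop : {z : ℂ | 1 / 2 + 2 * ε < z.re} ∈ nhds s :=
    (isOpen_lt continuous_const Complex.continuous_re).mem_nhds (by
      simp only [Set.mem_ofPred_eq]; linarith)
  have := hasDerivAt_integral_of_dominated_loc_of_deriv_le (μ := (volume : Measure ℝ))
    (F := gk) (x₀ := s)
    (F' := fun z t => -(gk z t * Complex.log ((1 + t ^ 2 : ℝ) : ℂ)))
    (bound := fun t => (1 + t ^ 2) ^ (-(1/2 + ε)) / ε) hop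
    (Filter.Eventually.of_forall fun z => (gk_cont z).aestronglyMeasurable) (gk_int h) ?_ ?_ ?_ ?_
  · exact this.2.differentiableAt
  · refine Continuous.aestronglyMeasurable ?_
    refine ((gk_cont s).mul ?_).neg
    refine continuous_iff_continuousAt.2 fun t => ?_
    refine ContinuousAt.clog (by fun_prop) (Complex.ofReal_mem_slitPlane.2 (one_add_sq_pos t))
  · refine Filter.Eventually.of_forall fun t z hz => ?_
    have hp := one_add_sq_pos t
    have h1 : 1 ≤ 1 + t ^ 2 := by nlinarith
    rw [norm_neg, norm_mul, gk_norm, ← Complex.ofReal_log hp.le, Complex.norm_real, Real.norm_eq_abs,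
      abs_of_nonneg (Real.log_nonneg h1)]
    have h2 := Real.log_le_rpow_div hp.le hε0
    calc (1 + t ^ 2) ^ (-z.re) * Real.log (1 + t ^ 2)
        ≤ (1 + t ^ 2) ^ (-(1/2 + 2 * ε)) * ((1 + t ^ 2) ^ ε / ε) := by
          refine mul_le_mul ?_ h2 (Real.log_nonneg h1) (by positivity)
          exact Real.rpow_le_rpow_of_exponent_le h1 (by
            simp only [Set.mem_ofPred_eq] at hz; linarith)
      _ = _ := by
          rw [mul_div_assoc', ← Real.rpow_add hp]; congr 2; ring
  · exact (b_integrable (by linarith)).div_const _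
  · refine Filter.Eventually.of_forall fun t z hz => ?_
    have hne : ((1 + t ^ 2 : ℝ) : ℂ) ≠ 0 := by exact_mod_cast (one_add_sq_pos t).ne'
    have := (hasDerivAt_neg z).const_cpow (c := ((1 + t ^ 2 : ℝ) : ℂ)) (Or.inl hne)
    simpa [gk] using this

/-- the row summand -/
noncomputable def qf (u v : ℝ) (s : ℂ) (t : ℝ) : ℂ := (((t + u) ^ 2 + v ^ 2 : ℝ) : ℂ) ^ (-s)

lemma qf_eq {v : ℝ} (hv : 0 < v) (u : ℝ) (s : ℂ) (t : ℝ) :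
    qf u v s t = (v : ℂ) ^ (-2 * s) * gk s ((t + u) / v) := by
  have e : (t + u) ^ 2 + v ^ 2 = v ^ 2 * (1 + ((t + u) / v) ^ 2) := by field_simp; ring
  rw [qf, e, gk, Complex.ofReal_mul, Complex.mul_cpow_ofReal_nonneg (by positivity) (by positivity)]
  congr 1
  rw [pow_two, Complex.ofReal_mul, Complex.mul_cpow_ofReal_nonneg hv.le hv.le,
    ← Complex.cpow_add _ _ (by exact_mod_cast hv.ne')]
  congr 1; ring

lemma qf_deriv {v : ℝ} (hv : 0 < v) (u : ℝ) (s : ℂ) (t : ℝ) :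
    HasDerivAt (qf u v s) ((v : ℂ) ^ (-2 * s) * (gk' s ((t + u) / v) * ((1 / v : ℝ) : ℂ))) t := by
  have e : qf u v s = fun t => (v : ℂ) ^ (-2 * s) * gk s ((t + u) / v) := by
    ext t; exact qf_eq hv u s t
  rw [e]
  have h1 : HasDerivAt (fun t : ℝ => (t + u) / v) (1 / v) t :=
    ((hasDerivAt_id t).add_const u).div_const v
  have := (gk_deriv s ((t + u) / v)).scomp t h1
  refine HasDerivAt.const_mul _ ?_
  rw [Complex.real_smul, mul_comm] at this
  exact this

lemma qf_int {v : ℝ} (hv : 0 < v) (u : ℝ) {s : ℂ} (hs : 1 / 2 < s.re) :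
    Integrable (qf u v s) := by
  have e : qf u v s = fun t => (v : ℂ) ^ (-2 * s) * gk s ((t + u) / v) := by
    ext t; exact qf_eq hv u s t
  rw [e]
  exact (((gk_int hs).comp_div hv.ne').comp_add_right u).const_mul _

lemma qf_integral {v : ℝ} (hv : 0 < v) (u : ℝ) (s : ℂ) :
    ∫ t, qf u v s t = (v : ℂ) ^ (1 - 2 * s) * BC s := by
  have e : qf u v s = fun t => (v : ℂ) ^ (-2 * s) * gk s ((t + u) / v) := by
    ext t; exact qf_eq hv u s t
  rw [e, integral_const_mul, integral_add_right_eq_self (fun t => gk s (t / v)) u,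
    Measure.integral_comp_div, abs_of_pos hv, Complex.real_smul, ← BC, ← mul_assoc]
  congr 1
  have hv' : (v : ℂ) ≠ 0 := by exact_mod_cast hv.ne'
  rw [show 1 - 2 * s = -2 * s + 1 by ring, Complex.cpow_add _ _ hv', Complex.cpow_one]

lemma qf_row {v : ℝ} (hv : 0 < v) (u : ℝ) {s : ℂ} (hs : 1 / 2 < s.re) :
    Summable (fun m : ℤ => ‖qf u v s m‖) ∧
      ‖(∑' m : ℤ, qf u v s m) - (v : ℂ) ^ (1 - 2 * s) * BC s‖ ≤ v ^ (-2 * s.re) * (‖s‖ * bR s.re) := by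
  have hi : Integrable (fun t => (v : ℂ) ^ (-2 * s) * (gk' s ((t + u) / v) * ((1 / v : ℝ) : ℂ))) :=
    ((((gk'_int hs).comp_div hv.ne').comp_add_right u).mul_const _).const_mul _
  have := row_compare _ _ (qf_deriv hv u s) (qf_int hv u hs) hi
  refine ⟨this.1, ?_⟩
  rw [← qf_integral hv u]
  refine this.2.trans ?_
  simp_rw [norm_mul]
  rw [integral_const_mul, integral_mul_const,
    integral_add_right_eq_self (fun t => ‖gk' s (t / v)‖) u,
    Measure.integral_comp_div (fun t => ‖gk' s t‖), abs_of_pos hv, smul_eq_mul,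
    Complex.norm_cpow_eq_rpow_re_of_pos hv, Complex.norm_real, Real.norm_eq_abs,
    abs_of_pos (by positivity)]
  have e1 : (-2 * s).re = -2 * s.re := by simp
  rw [e1]
  refine mul_le_mul_of_nonneg_left ?_ (by positivity)
  have : v * (∫ t, ‖gk' s t‖) * (1 / v) = ∫ t, ‖gk' s t‖ := by field_simp
  rw [this]
  exact gk'_int_le hs

lemma rpow_le_add {q a b x : ℝ} (hq : 0 < q) (h1 : a ≤ x) (h2 : x ≤ b) :
    q ^ (-x) ≤ q ^ (-a) + q ^ (-b) := by
  rcases le_total 1 q with h | h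
  · have := Real.rpow_le_rpow_of_exponent_le h (show -x ≤ -a by linarith)
    have : 0 ≤ q ^ (-b) := by positivity
    linarith
  · have := Real.rpow_le_rpow_of_exponent_ge hq h (show -b ≤ -x by linarith)
    have : 0 ≤ q ^ (-a) := by positivity
    linarith

lemma qf_norm {v : ℝ} (hv : 0 < v) (u : ℝ) (s : ℂ) (t : ℝ) :
    ‖qf u v s t‖ = ((t + u) ^ 2 + v ^ 2) ^ (-s.re) := by
  rw [qf, Complex.norm_cpow_eq_rpow_re_of_pos (by positivity)]; simp

/-- open box around `s` used for locally uniform convergence -/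
def boxS (σ₀ M : ℝ) : Set ℂ := {z : ℂ | σ₀ < z.re} ∩ Metric.ball 0 M

lemma boxS_open (σ₀ M : ℝ) : IsOpen (boxS σ₀ M) :=
  (isOpen_lt continuous_const Complex.continuous_re).inter Metric.isOpen_ball

lemma boxS_re {σ₀ M : ℝ} {z : ℂ} (h : z ∈ boxS σ₀ M) : σ₀ < z.re ∧ z.re ≤ M ∧ ‖z‖ ≤ M := by
  have h1 : ‖z‖ < M := by simpa using h.2
  exact ⟨h.1, ((Complex.re_le_norm z).trans h1.le), h1.le⟩

lemma mem_boxS {s : ℂ} (hs : 1 / 2 < s.re) :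
    s ∈ boxS ((1/2 + s.re)/2) (‖s‖ + 1) := by
  refine ⟨?_, ?_⟩
  · simp only [Set.mem_ofPred_eq]; linarith
  · simp

lemma qf_row_diff {v : ℝ} (hv : 0 < v) (u : ℝ) {s : ℂ} (hs : 1 / 2 < s.re) :
    DifferentiableAt ℂ (fun s => ∑' m : ℤ, qf u v s m) s := by
  set σ₀ := (1/2 + s.re)/2 with hσ
  have hσ0 : 1/2 < σ₀ := by rw [hσ]; linarith
  set M := ‖s‖ + 1 with hM
  have hmem : s ∈ boxS σ₀ M := mem_boxS hs
  have hM2 : 1 / 2 < M := by have := (boxS_re hmem).2.1; linarith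
  have hsum : Summable fun m : ℤ => ((m + u) ^ 2 + v ^ 2) ^ (-σ₀) + ((m + u) ^ 2 + v ^ 2) ^ (-M) := by
    have h1 := (qf_row hv u (s := (σ₀ : ℂ)) (by simpa using hσ0)).1
    have h2 := (qf_row hv u (s := (M : ℂ)) (by simpa using hM2)).1
    simp only [qf_norm hv, Complex.ofReal_re] at h1 h2
    exact h1.add h2
  have := Complex.differentiableOn_tsum_of_summable_norm hsum (F := fun (m : ℤ) z => qf u v z m)
    (U := boxS σ₀ M) ?_ (boxS_open _ _) ?_
  · exact this.differentiableAt ((boxS_open _ _).mem_nhds hmem)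
  · intro m z hz
    have hne : ((((m:ℝ) + u) ^ 2 + v ^ 2 : ℝ) : ℂ) ≠ 0 := by
      have : (0:ℝ) < ((m:ℝ) + u) ^ 2 + v ^ 2 := by positivity
      exact_mod_cast this.ne'
    have := (hasDerivAt_neg z).const_cpow (c := ((((m:ℝ) + u) ^ 2 + v ^ 2 : ℝ) : ℂ)) (Or.inl hne)
    exact this.differentiableAt.differentiableWithinAt
  · intro m z hz
    rw [qf_norm hv]
    have := boxS_re hz
    exact rpow_le_add (by positivity) this.1.le this.2.1

/-- row error term -/
noncomputable def er (u y : ℝ) (n : ℤ) (s : ℂ) : ℂ :=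
  if n = 0 then 0 else
    (∑' m : ℤ, qf (n * u) (|(n:ℝ)| * y) s m) - ((|(n:ℝ)| * y : ℝ) : ℂ) ^ (1 - 2 * s) * BC s

lemma er_diff {y : ℝ} (hy : 0 < y) (u : ℝ) (n : ℤ) {s : ℂ} (hs : 1 / 2 < s.re) :
    DifferentiableAt ℂ (er u y n) s := by
  by_cases hn : n = 0
  · have : er u y n = fun _ => 0 := by ext z; simp [er, hn]
    rw [this]; fun_prop
  · have hv : 0 < |(n:ℝ)| * y := by positivity
    have : er u y n = fun z => (∑' m : ℤ, qf (n * u) (|(n:ℝ)| * y) z m) -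
      ((|(n:ℝ)| * y : ℝ) : ℂ) ^ (1 - 2 * z) * BC z := by ext z; simp only [er, hn, if_false]
    rw [this]
    refine (qf_row_diff hv _ hs).sub (DifferentiableAt.mul ?_ (BC_diff hs))
    refine DifferentiableAt.const_cpow (by fun_prop) (Or.inl ?_)
    exact_mod_cast hv.ne'

lemma er_le {y : ℝ} (hy : 0 < y) (u : ℝ) (n : ℤ) {s : ℂ} (hs : 1 / 2 < s.re) :
    ‖er u y n s‖ ≤ |(n:ℝ)| ^ (-(2 * s.re)) * (y ^ (-(2 * s.re)) * (‖s‖ * bR s.re)) := by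
  by_cases hn : n = 0
  · have : 0 ≤ bR s.re := bR_nonneg _
    simp only [er, hn, if_true, norm_zero]
    positivity
  · have hv : 0 < |(n:ℝ)| * y := by positivity
    simp only [er, hn, if_false]
    refine ((qf_row hv (n * u) hs).2).trans (le_of_eq ?_)
    rw [Real.mul_rpow (abs_nonneg _) hy.le]
    ring_nf

lemma er_sum {y : ℝ} (hy : 0 < y) (u : ℝ) {s : ℂ} (hs : 1 / 2 < s.re) :
    Summable (fun n : ℤ => ‖er u y n s‖) :=
  Summable.of_nonneg_of_le (fun _ => norm_nonneg _) (fun n => er_le hy u n hs)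
    ((Real.summable_abs_int_rpow (by linarith)).mul_right _)

lemma er_sum_diff {y : ℝ} (hy : 0 < y) (u : ℝ) {s : ℂ} (hs : 1 / 2 < s.re) :
    DifferentiableAt ℂ (fun s => ∑' n : ℤ, er u y n s) s := by
  set σ₀ := (1/2 + s.re)/2 with hσ
  have hσ0 : 1/2 < σ₀ := by rw [hσ]; linarith
  set M := ‖s‖ + 1 with hM
  have hmem : s ∈ boxS σ₀ M := mem_boxS hs
  have hsum := (Real.summable_abs_int_rpow (b := 2 * σ₀) (by linarith)).mul_right
      ((y ^ (-(2 * σ₀)) + y ^ (-(2 * M))) * (M * bR σ₀))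
  have := Complex.differentiableOn_tsum_of_summable_norm hsum (F := fun (n : ℤ) z => er u y n z)
    (U := boxS σ₀ M) ?_ (boxS_open _ _) ?_
  · exact this.differentiableAt ((boxS_open _ _).mem_nhds hmem)
  · intro n z hz
    exact (er_diff hy u n (hσ0.trans (boxS_re hz).1)).differentiableWithinAt
  · intro n z hz
    obtain ⟨h1, h2, h3⟩ := boxS_re hz
    have hb : 0 ≤ bR z.re := bR_nonneg _
    by_cases hn : n = 0
    · have : 0 ≤ bR σ₀ := bR_nonneg _
      have hM0 : 0 ≤ M := (norm_nonneg z).trans h3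
      simp only [er, hn, if_true, norm_zero]
      positivity
    refine (er_le hy u n (hσ0.trans h1)).trans ?_
    have hn1 : 1 ≤ |(n:ℝ)| := by exact_mod_cast Int.one_le_abs hn
    have hM0 : 0 ≤ M := (norm_nonneg z).trans h3
    refine mul_le_mul (Real.rpow_le_rpow_of_exponent_le hn1 (by linarith)) ?_ (by positivity) (by positivity)
    refine mul_le_mul (rpow_le_add hy (by linarith) (by linarith)) ?_ (by positivity) (by positivity)
    exact mul_le_mul h3 (bR_anti hσ0 h1.le) hb hM0

noncomputable def zi (w : ℂ) (n : ℤ) : ℂ := if n = 0 then (0:ℂ) else ((|(n:ℝ)| : ℝ) : ℂ) ^ (-w)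

lemma zeta_int {w : ℂ} (hw : 1 < w.re) : HasSum (zi w) (2 * riemannZeta w) := by
  have hw0 : w ≠ 0 := by rintro rfl; simp at hw; linarith
  have h0 : HasSum (fun n : ℕ => 1 / (n:ℂ) ^ w) (riemannZeta w) := by
    rw [zeta_eq_tsum_one_div_nat_cpow hw]
    exact (Complex.summable_one_div_nat_cpow.2 hw).hasSum
  have e1 : (fun n : ℕ => zi w (n : ℤ)) = fun n : ℕ => 1 / (n:ℂ) ^ w := by
    ext n
    by_cases hn : n = 0
    · simp [zi, hn, hw0]
    · simp [zi, hn, Complex.cpow_neg]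
  have e2 : (fun n : ℕ => zi w (-(n : ℤ))) = fun n : ℕ => 1 / (n:ℂ) ^ w := by
    rw [← e1]
    ext n
    simp [zi]
  have := HasSum.of_nat_of_neg (f := zi w) (by rw [e1]; exact h0) (by rw [e2]; exact h0)
  rw [two_mul]
  simpa [zi] using this

/-- lattice summand -/
noncomputable def lat (u y : ℝ) (s : ℂ) (p : ℤ × ℤ) : ℂ :=
  ((((p.2:ℝ) + p.1 * u) ^ 2 + (p.1 * y) ^ 2 : ℝ) : ℂ) ^ (-s)

lemma lat_eq_qf (u y : ℝ) (s : ℂ) (n m : ℤ) :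
    lat u y s (n, m) = qf (n * u) (|(n:ℝ)| * y) s m := by
  simp only [lat, qf, mul_pow, sq_abs]

lemma lat_zero (u y : ℝ) {s : ℂ} (hs : s ≠ 0) (m : ℤ) : lat u y s (0, m) = zi (2 * s) m := by
  by_cases hm : m = 0
  · simp [lat, zi, hm, hs]
  · have hp : 0 < |(m:ℝ)| := by positivity
    have hne : ((|(m:ℝ)| : ℝ) : ℂ) ≠ 0 := by exact_mod_cast hp.ne'
    have e : (((m:ℝ) + (0:ℤ) * u) ^ 2 + ((0:ℤ) * y) ^ 2 : ℝ) = |(m:ℝ)| * |(m:ℝ)| := by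
      rw [abs_mul_abs_self]; push_cast; ring
    simp only [lat, zi, hm, if_false]
    rw [e, Complex.ofReal_mul, Complex.mul_cpow_ofReal_nonneg hp.le hp.le, ← Complex.cpow_add _ _ hne]
    congr 1; ring

/-- analytic remainder of the lattice sum -/
noncomputable def Grem (u y : ℝ) (s : ℂ) : ℂ :=
  (y : ℂ) ^ (1 - 2 * s) * BC s * (2 * riemannZeta (2 * s - 1)) + ∑' n : ℤ, er u y n s

lemma Grem_diff {y : ℝ} (hy : 0 < y) (u : ℝ) {s : ℂ} (hs : 1 / 2 < s.re) (hs1 : s ≠ 1) :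
    DifferentiableAt ℂ (Grem u y) s := by
  refine DifferentiableAt.add ?_ (er_sum_diff hy u hs)
  refine DifferentiableAt.mul (DifferentiableAt.mul ?_ (BC_diff hs)) ?_
  · exact DifferentiableAt.const_cpow (by fun_prop) (Or.inl (by exact_mod_cast hy.ne'))
  · refine DifferentiableAt.const_mul ?_ _
    have h1 : DifferentiableAt ℂ riemannZeta (2 * s - 1) := differentiableAt_riemannZeta (by
      intro h; apply hs1; linear_combination h / 2)
    exact DifferentiableAt.comp s (f := fun s : ℂ => 2 * s - 1) h1 (by fun_prop)

/-- the constant in the bound for the remainder -/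
noncomputable def Crem (s : ℂ) : ℝ :=
  ‖BC s * (2 * riemannZeta (2 * s - 1))‖ + 2 * ((‖s‖ * bR s.re) * ∑' n : ℤ, |(n:ℝ)| ^ (-(2 * s.re)))

lemma Crem_nonneg (s : ℂ) : 0 ≤ Crem s := by
  have := bR_nonneg s.re
  have h : 0 ≤ ∑' n : ℤ, |(n:ℝ)| ^ (-(2 * s.re)) := tsum_nonneg fun n => by positivity
  unfold Crem
  positivity

lemma Grem_le {y : ℝ} (hy : 1 / 2 ≤ y) (u : ℝ) {s : ℂ} (hs : 1 / 2 < s.re) :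
    ‖Grem u y s‖ ≤ Crem s * y ^ (1 - 2 * s.re) := by
  have hy0 : 0 < y := by linarith
  have h1 : ‖∑' n : ℤ, er u y n s‖ ≤
      (∑' n : ℤ, |(n:ℝ)| ^ (-(2 * s.re))) * (y ^ (-(2 * s.re)) * (‖s‖ * bR s.re)) := by
    refine (norm_tsum_le_tsum_norm (er_sum hy0 u hs)).trans ?_
    rw [← tsum_mul_right]
    exact (er_sum hy0 u hs).tsum_le_tsum (fun n => er_le hy0 u n hs)
      ((Real.summable_abs_int_rpow (by linarith)).mul_right _)
  have h2 : y ^ (-(2 * s.re)) ≤ 2 * y ^ (1 - 2 * s.re) := by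
    rw [show 1 - 2 * s.re = -(2 * s.re) + 1 by ring, Real.rpow_add_one hy0.ne']
    have : 0 < y ^ (-(2 * s.re)) := by positivity
    nlinarith
  have hb := bR_nonneg s.re
  have hT : 0 ≤ ∑' n : ℤ, |(n:ℝ)| ^ (-(2 * s.re)) := tsum_nonneg fun n => by positivity
  have h3 : ‖(y : ℂ) ^ (1 - 2 * s)‖ = y ^ (1 - 2 * s.re) := by
    rw [Complex.norm_cpow_eq_rpow_re_of_pos hy0]; simp
  unfold Grem Crem
  refine (norm_add_le _ _).trans ?_
  rw [mul_assoc, norm_mul, h3, add_mul]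
  refine add_le_add (le_of_eq (mul_comm _ _)) (h1.trans ?_)
  calc _ ≤ (∑' n : ℤ, |(n:ℝ)| ^ (-(2 * s.re))) * ((2 * y ^ (1 - 2 * s.re)) * (‖s‖ * bR s.re)) := by
        gcongr
    _ = _ := by ring

lemma lat_summable {y : ℝ} (hy : 0 < y) (u : ℝ) {s : ℂ} (hs : 1 < s.re) :
    Summable (fun p => ‖lat u y s p‖) := by
  have hs0 : s ≠ 0 := by rintro rfl; simp at hs; linarith
  have hre : 1 / 2 < s.re := by linarith
  have hrow : ∀ n : ℤ, Summable fun m : ℤ => ‖lat u y s (n, m)‖ := by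
    intro n
    by_cases hn : n = 0
    · subst hn
      simp only [lat_zero u y hs0]
      exact (zeta_int (w := 2 * s) (by simp; linarith)).summable.norm
    · have hv : 0 < |(n:ℝ)| * y := by positivity
      simp only [lat_eq_qf]
      exact (qf_row hv _ hre).1
  rw [summable_prod_of_nonneg (fun p => norm_nonneg _)]
  refine ⟨hrow, ?_⟩
  have hσ : 1 / 2 < ((s.re : ℝ) : ℂ).re := by simpa using hre
  have hb := bR_nonneg s.re
  set K : ℝ := y ^ (1 - 2 * s.re) * ‖BC s.re‖ + y ^ (-(2 * s.re)) * (‖(s.re : ℂ)‖ * bR s.re) with hK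
  have hK0 : 0 ≤ K := by positivity
  have hsum : Summable fun n : ℤ => |(n:ℝ)| ^ (-(2 * s.re - 1)) * K :=
    (Real.summable_abs_int_rpow (by linarith)).mul_right _
  refine (summable_congr_cofinite (f := fun n : ℤ => if n = 0 then 0 else ∑' m, ‖lat u y s (n, m)‖) ?_).1
    (Summable.of_nonneg_of_le (fun n => ?_) (fun n => ?_) hsum)
  · have : ({0}ᶜ : Set ℤ) ∈ Filter.cofinite := (Set.finite_singleton 0).compl_mem_cofinite
    filter_upwards [this] with n hn
    simp only [Set.mem_compl_iff, Set.mem_singleton_iff] at hn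
    simp [hn]
  · split_ifs
    · exact le_rfl
    · exact tsum_nonneg fun _ => norm_nonneg _
  · split_ifs with hn
    · positivity
    have hv : 0 < |(n:ℝ)| * y := by positivity
    have hn1 : 1 ≤ |(n:ℝ)| := by exact_mod_cast Int.one_le_abs hn
    have e : ((∑' m, ‖lat u y s (n, m)‖ : ℝ) : ℂ) = ∑' m : ℤ, qf (n * u) (|(n:ℝ)| * y) s.re m := by
      rw [Complex.ofReal_tsum]
      refine tsum_congr fun m => ?_
      rw [lat_eq_qf, qf_norm hv, Complex.ofReal_cpow (by positivity), qf]
      simp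
    have h0 : 0 ≤ ∑' m, ‖lat u y s (n, m)‖ := tsum_nonneg fun _ => norm_nonneg _
    have h1 := (qf_row hv (n * u) hσ).2
    rw [← e, Complex.ofReal_re] at h1
    have h2 := norm_le_norm_add_norm_sub' (((∑' m, ‖lat u y s (n, m)‖ : ℝ) : ℂ))
      (((|(n:ℝ)| * y : ℝ) : ℂ) ^ (1 - 2 * (s.re : ℂ)) * BC s.re)
    rw [Complex.norm_real, Real.norm_eq_abs, abs_of_nonneg h0] at h2
    refine h2.trans ((add_le_add_right h1 _).trans ?_)
    rw [norm_mul, Complex.norm_cpow_eq_rpow_re_of_pos hv]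
    have e3 : (1 - 2 * (s.re : ℂ)).re = 1 - 2 * s.re := by simp
    rw [e3, Real.mul_rpow (abs_nonneg _) hy.le, Real.mul_rpow (abs_nonneg _) hy.le, hK, mul_add]
    refine add_le_add (le_of_eq ?_) ?_
    · rw [show 1 - 2 * s.re = -(2 * s.re - 1) by ring, mul_assoc]
    · rw [mul_assoc, show -2 * s.re = -(2 * s.re) by ring]
      gcongr
      linarith

lemma lat_hasSum {y : ℝ} (hy : 0 < y) (u : ℝ) {s : ℂ} (hs : 1 < s.re) :
    HasSum (lat u y s) (2 * riemannZeta (2 * s) + Grem u y s) := by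
  have hs0 : s ≠ 0 := by rintro rfl; simp at hs; linarith
  have hre : 1 / 2 < s.re := by linarith
  have hsm := (lat_summable hy u hs).of_norm
  have key : HasSum (fun n : ℤ => ∑' m, lat u y s (n, m)) (2 * riemannZeta (2 * s) + Grem u y s) := by
    have h1 : HasSum (fun n : ℤ => if n = 0 then 2 * riemannZeta (2 * s) else 0)
        (2 * riemannZeta (2 * s)) := hasSum_ite_eq 0 _
    have h2 := (zeta_int (w := 2 * s - 1) (by simp; linarith)).mul_left ((y : ℂ) ^ (1 - 2 * s) * BC s)
    have h3 := (er_sum hy u hre).of_norm.hasSum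
    have h4 := h1.add (h2.add h3)
    change HasSum _ (2 * riemannZeta (2 * s) + Grem u y s) at h4
    convert h4 using 1
    ext n
    by_cases hn : n = 0
    · subst hn
      simp only [lat_zero u y hs0, (zeta_int (w := 2 * s) (by simp; linarith)).tsum_eq]
      simp [zi, er]
    · simp only [hn, if_false, zi, er, lat_eq_qf]
      rw [Complex.ofReal_mul, Complex.mul_cpow_ofReal_nonneg (abs_nonneg _) hy.le,
        show -(2 * s - 1) = 1 - 2 * s by ring]
      ring
  rw [← key.tsum_eq, ← hsm.tsum_prod]
  exact hsm.hasSum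

end Mordell


namespace Mordell
open NumberField

/-- data of an imaginary quadratic field with a chosen complex embedding -/
structure QD (K : Type) [Field K] [NumberField K] where
  d : ℤ
  neg : d < 0
  sqf : Squarefree d
  fin2 : Module.finrank ℚ K = 2
  α : K
  sq : α ^ 2 = (d : K)
  φ : K →ₐ[ℚ] ℂ
  φα : φ α = ((Real.sqrt (-d) : ℝ) : ℂ) * I

variable {K : Type} [Field K] [NumberField K]

lemma exists_QD (d : ℤ) (neg : d < 0) (sqf : Squarefree d) (fin2 : Module.finrank ℚ K = 2)
    (h : ∃ α : K, α ^ 2 = (d : K)) : ∃ D : QD K, D.d = d := by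
  obtain ⟨α, hα⟩ := h
  obtain ⟨ψ⟩ : Nonempty (K →+* ℂ) := inferInstance
  set φ : K →ₐ[ℚ] ℂ := ψ.toRatAlgHom with hφ
  have h0 : (0:ℝ) ≤ -d := by
    have : (d:ℝ) < 0 := by exact_mod_cast neg
    linarith
  have h1 : (((Real.sqrt (-d) : ℝ) : ℂ) * I) ^ 2 = (φ α) ^ 2 := by
    rw [mul_pow, I_sq, ← Complex.ofReal_pow, Real.sq_sqrt h0, ← map_pow, hα]
    simp
  rcases sq_eq_sq_iff_eq_or_eq_neg.1 h1 with h2 | h2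
  · exact ⟨⟨d, neg, sqf, fin2, α, hα, φ, h2.symm⟩, rfl⟩
  · exact ⟨⟨d, neg, sqf, fin2, -α, by rw [neg_sq, hα], φ, by rw [map_neg, h2]⟩, rfl⟩

namespace QD
variable (D : QD K)

/-- square root of the absolute value of `d` -/
noncomputable def r : ℝ := Real.sqrt (-D.d)

lemma r_pos : 0 < D.r := by
  have : (D.d:ℝ) < 0 := by exact_mod_cast D.neg
  exact Real.sqrt_pos.2 (by linarith)

lemma r_sq : D.r ^ 2 = -D.d := by
  have : (D.d:ℝ) < 0 := by exact_mod_cast D.neg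
  exact Real.sq_sqrt (by linarith)

lemma φ_α : D.φ D.α = (D.r : ℂ) * I := D.φα

lemma φ_pq (p q : ℚ) : D.φ (p + q * D.α) = (p : ℂ) + (q * D.r : ℝ) * I := by
  rw [map_add, map_mul, φ_α, map_ratCast, map_ratCast]; push_cast; ring

lemma rep (x : K) : ∃ p q : ℚ, x = p + q * D.α := by
  have hli : LinearIndependent ℚ ![(1:K), D.α] := by
    rw [LinearIndependent.pair_iff]
    intro s t hst
    have h := congrArg D.φ hst
    rw [show s • (1:K) + t • D.α = s + t * D.α by simp [Algebra.smul_def], φ_pq, map_zero] at h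
    have hre := congrArg Complex.re h
    have him := congrArg Complex.im h
    simp at hre him
    have := D.r_pos.ne'
    simp [this] at him
    exact ⟨hre, him⟩
  have := hli.span_eq_top_of_card_eq_finrank (by simp [D.fin2])
  have hx : x ∈ Submodule.span ℚ (Set.range ![(1:K), D.α]) := by rw [this]; trivial
  rw [Matrix.range_cons, Matrix.range_cons, Matrix.range_empty, Set.union_empty,
    Set.singleton_union, Submodule.mem_span_pair] at hx
  obtain ⟨a, b, hab⟩ := hx
  exact ⟨a, b, by rw [← hab]; simp [Algebra.smul_def]⟩

open scoped Classical in
lemma univ_eq : (Finset.univ : Finset (K →ₐ[ℚ] ℂ)) =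
    {D.φ, ((Complex.conjAe : ℂ →ₐ[ℝ] ℂ).restrictScalars ℚ).comp D.φ} := by
  symm
  apply Finset.eq_of_subset_of_card_le (Finset.subset_univ _)
  rw [Finset.card_pair, Finset.card_univ, AlgHom.card, D.fin2]
  intro h
  have := congrArg (fun f : K →ₐ[ℚ] ℂ => (f D.α).im) h
  simp [φ_α] at this
  have h2 := D.r_pos
  linarith

lemma ne_pair : D.φ ≠ ((Complex.conjAe : ℂ →ₐ[ℝ] ℂ).restrictScalars ℚ).comp D.φ := by
  intro h
  have := congrArg (fun f : K →ₐ[ℚ] ℂ => (f D.α).im) h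
  simp [φ_α] at this
  have h2 := D.r_pos
  linarith

lemma norm_eq (x : K) : ((Algebra.norm ℚ x : ℚ) : ℝ) = normSq (D.φ x) := by
  classical
  have h := Algebra.norm_eq_prod_embeddings ℚ ℂ x
  rw [D.univ_eq, Finset.prod_pair D.ne_pair] at h
  have h2 : ((Algebra.norm ℚ x : ℚ) : ℂ) = ((normSq (D.φ x) : ℝ) : ℂ) := by
    rw [Complex.normSq_eq_conj_mul_self, mul_comm]; simpa using h
  exact_mod_cast h2

lemma trace_eq (x : K) : ((Algebra.trace ℚ K x : ℚ) : ℝ) = 2 * (D.φ x).re := by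
  classical
  have h := trace_eq_sum_embeddings (K := ℚ) ℂ (x := x)
  rw [D.univ_eq, Finset.sum_pair D.ne_pair] at h
  have := congrArg Complex.re h
  simp at this
  linarith

/-- coordinates of integers -/
lemma int_rep (x : 𝓞 K) : ∃ t v : ℤ, (2 : K) * x = t + v * D.α := by
  obtain ⟨p, q, h⟩ := D.rep (x : K)
  have h1 := D.trace_eq (x : K)
  have h2 := D.norm_eq (x : K)
  rw [← Algebra.coe_trace_int, h, φ_pq] at h1
  rw [← Algebra.coe_norm_int, h, φ_pq] at h2
  simp [Complex.normSq_apply] at h1 h2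
  set t := Algebra.trace ℤ (𝓞 K) x
  set n := Algebra.norm ℤ x
  have h1' : (t : ℚ) = 2 * p := by exact_mod_cast h1
  have h2' : (n : ℚ) = p * p + q * q * (-D.d) := by
    have : (n : ℝ) = p * p + q * q * (-D.d) := by rw [h2, ← D.r_sq]; ring
    exact_mod_cast this
  have h3 : (2 * q) ^ 2 * D.d = ((t ^ 2 - 4 * n : ℤ) : ℚ) := by
    push_cast; rw [h1', h2']; ring
  have hden : (2 * q).den = 1 := by
    set w := 2 * q
    have h4 : w.num ^ 2 * D.d = (t ^ 2 - 4 * n) * (w.den : ℤ) ^ 2 := by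
      have : (w.num : ℚ) = w * w.den := (Rat.mul_den_eq_num w).symm
      have h5 : ((w.num ^ 2 * D.d : ℤ) : ℚ) = (((t ^ 2 - 4 * n) * (w.den : ℤ) ^ 2 : ℤ) : ℚ) := by
        rw [Int.cast_mul (t ^ 2 - 4 * n), ← h3]
        push_cast; rw [this]; ring
      exact_mod_cast h5
    have hcop : IsCoprime ((w.den : ℤ) ^ 2) (w.num ^ 2) := by
      apply IsCoprime.pow
      have := w.reduced
      exact (Int.isCoprime_iff_nat_coprime.2 (by simpa using this)).symm
    have hdvd : (w.den : ℤ) ^ 2 ∣ D.d :=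
      hcop.dvd_of_dvd_mul_left (Dvd.intro_left _ h4.symm)
    have := D.sqf (w.den : ℤ) (by rw [← pow_two]; exact hdvd)
    have := Int.isUnit_iff.1 this
    omega
  refine ⟨t, (2 * q).num, ?_⟩
  have h6 : ((2 * q).num : ℚ) = 2 * q := by
    have := Rat.mul_den_eq_num (2 * q)
    rw [hden] at this; simpa using this.symm
  have h7 : (((2 * q).num : ℤ) : K) = 2 * (q : K) := by
    have := congrArg (fun z : ℚ => (z : K)) h6
    push_cast at this
    simpa using this
  have h8 : (t : K) = 2 * (p : K) := by
    have := congrArg (fun z : ℚ => (z : K)) h1'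
    push_cast at this
    simpa using this
  rw [h, h7, h8]; ring

lemma int_im (x : 𝓞 K) : ∃ v : ℤ, (D.φ x).im = v * D.r / 2 := by
  obtain ⟨t, v, h⟩ := D.int_rep x
  have := congrArg (fun z => (D.φ z).im) h
  have h2 : D.φ 2 = 2 := map_ofNat _ _
  simp [φ_α, h2] at this
  exact ⟨v, by linarith⟩

/-- an integer with small imaginary part is a rational integer -/
lemma int_of_small (x : 𝓞 K) (h : |(D.φ x).im| < D.r / 2) : ∃ m : ℤ, x = m := by
  obtain ⟨t, v, hv⟩ := D.int_rep x
  have him := congrArg (fun z => (D.φ z).im) hv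
  have h2 : D.φ 2 = 2 := map_ofNat _ _
  simp [φ_α, h2] at him
  have hr := D.r_pos
  have hv0 : v = 0 := by
    have h1 : |(v:ℝ)| < 1 := by
      have : (D.φ x).im = v * (D.r / 2) := by linarith
      rw [this, abs_mul, abs_of_pos (by positivity : 0 < D.r / 2)] at h
      nlinarith
    have : |v| < 1 := by exact_mod_cast h1
    exact Int.abs_lt_one_iff.1 this
  rw [hv0] at hv
  have hx : (x : K) = algebraMap ℚ K (t / 2) := by
    simp only [Int.cast_zero, zero_mul, add_zero] at hv
    rw [map_div₀]
    simp [← hv]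
  have hi : IsIntegral ℤ (algebraMap ℚ K (t / 2)) := by rw [← hx]; exact x.2
  rw [isIntegral_algebraMap_iff (algebraMap ℚ K).injective] at hi
  obtain ⟨m, hm⟩ := IsIntegrallyClosed.isIntegral_iff.1 hi
  refine ⟨m, ?_⟩
  apply RingOfIntegers.ext
  rw [hx, ← hm]
  simp

lemma absNorm_span (x : 𝓞 K) : (Ideal.absNorm (Ideal.span {x}) : ℝ) = ‖D.φ x‖ ^ 2 := by
  have h := D.norm_eq (x : K)
  rw [← Algebra.coe_norm_int] at h
  have h0 : (0 : ℝ) ≤ (Algebra.norm ℤ x : ℤ) := by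
    have : ((Algebra.norm ℤ x : ℤ) : ℝ) = normSq (D.φ x) := by exact_mod_cast h
    rw [this]; exact normSq_nonneg _
  have h1 : 0 ≤ Algebra.norm ℤ x := by exact_mod_cast h0
  rw [Ideal.absNorm_span_singleton, ← Complex.normSq_eq_norm_sq, ← h]
  have : (((Algebra.norm ℤ x).natAbs : ℤ) : ℝ) = (Algebra.norm ℤ x : ℤ) := by
    rw [Int.natAbs_of_nonneg h1]
  rw [Int.cast_natCast] at this
  rw [this]; norm_cast

lemma φ_ne {x : 𝓞 K} (h : x ≠ 0) : D.φ x ≠ 0 := by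
  rw [map_ne_zero]; simpa using h

lemma span_eq_iff (hd : D.d < -4) (x y : 𝓞 K) :
    Ideal.span {x} = Ideal.span {y} ↔ x = y ∨ x = -y := by
  constructor
  · intro h
    obtain ⟨u, hu⟩ := Ideal.span_singleton_eq_span_singleton.1 h
    have h1 := D.absNorm_span (u : 𝓞 K)
    rw [Ideal.span_singleton_eq_top.2 u.isUnit, Ideal.absNorm_top] at h1
    have h2 : ‖D.φ (u : 𝓞 K)‖ = 1 := by
      have := norm_nonneg (D.φ (u : 𝓞 K))
      push_cast at h1; nlinarith
    have h3 : 1 < D.r / 2 := by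
      have := D.r_sq
      have h4 : (D.d : ℝ) < -4 := by exact_mod_cast hd
      have := D.r_pos
      nlinarith
    obtain ⟨m, hm⟩ := D.int_of_small (u : 𝓞 K) (((Complex.abs_im_le_norm _).trans h2.le).trans_lt h3)
    have h5 : m = 1 ∨ m = -1 := by
      rw [hm] at h2
      simp at h2
      have : |m| = 1 := by exact_mod_cast h2
      exact eq_or_eq_neg_of_abs_eq this
    rcases h5 with h5 | h5
    · left; rw [← hu, hm, h5]; simp
    · right; rw [← hu, hm, h5]; simp
  · rintro (h | h)
    · rw [h]
    · rw [h, Ideal.span_singleton_neg]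

end QD
end Mordell


namespace Mordell
open NumberField

lemma lattice_basis (Λ : AddSubgroup ℂ) (h1 : (1 : ℂ) ∈ Λ) (hmin : ∀ z ∈ Λ, z ≠ 0 → 1 ≤ ‖z‖)
    (him : ∃ z ∈ Λ, z.im ≠ 0) :
    ∃ τ ∈ Λ, 1 / 2 ≤ τ.im ∧ ∀ z ∈ Λ, ∃ n m : ℤ, z = m + n * τ := by
  have hintΛ : ∀ m : ℤ, (m : ℂ) ∈ Λ := fun m => by
    have := Λ.zsmul_mem h1 m
    simpa using this
  have hsmall : ∀ z ∈ Λ, |z.re| ≤ 1 / 2 → |z.im| < 1 / 2 → z = 0 := by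
    intro z hz hre him
    by_contra h0
    have := hmin z hz h0
    have h2 := Complex.sq_norm z
    rw [Complex.normSq_apply, ← sq, ← sq, ← sq_abs z.re, ← sq_abs z.im] at h2
    nlinarith [abs_nonneg z.re, abs_nonneg z.im]
  have hround : ∀ z ∈ Λ, ∃ w ∈ Λ, |w.re| ≤ 1 / 2 ∧ w.im = z.im := by
    intro z hz
    refine ⟨z - (round z.re : ℤ), Λ.sub_mem hz (hintΛ _), ?_, ?_⟩
    · simpa using abs_sub_round z.re
    · simp
  set H : AddSubgroup ℝ := Λ.map Complex.imAddGroupHom with hH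
  have hmemH : ∀ x, x ∈ H ↔ ∃ z ∈ Λ, z.im = x := by
    intro x; rw [hH, AddSubgroup.mem_map]; rfl
  obtain ⟨b, hb⟩ := AddSubgroup.cyclic_of_isolated_zero (H := H) (a := 1 / 2) (by norm_num) (by
    rw [Set.disjoint_left]
    intro x hx hx2
    obtain ⟨z, hz, rfl⟩ := (hmemH x).1 hx
    obtain ⟨w, hw, hre, hi⟩ := hround z hz
    have := hsmall w hw hre (by rw [hi, abs_of_pos hx2.1]; exact hx2.2)
    rw [← hi, this] at hx2
    simp at hx2)
  have hgen : ∀ z ∈ Λ, ∃ n : ℤ, z.im = n * |b| := by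
    intro z hz
    have : z.im ∈ H := (hmemH _).2 ⟨z, hz, rfl⟩
    rw [hb, AddSubgroup.mem_closure_singleton] at this
    obtain ⟨n, hn⟩ := this
    rcases abs_choice b with h | h
    · exact ⟨n, by rw [h, ← hn]; simp⟩
    · exact ⟨-n, by rw [h, ← hn]; simp⟩
  have hbH : |b| ∈ H := by
    have : b ∈ H := by rw [hb]; exact AddSubgroup.mem_closure_singleton_self b
    rcases abs_choice b with h | h
    · rwa [h]
    · rw [h]; exact H.neg_mem this
  obtain ⟨z0, hz0, hz0b⟩ := (hmemH _).1 hbH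
  obtain ⟨τ, hτ, hτre, hτim⟩ := hround z0 hz0
  rw [hz0b] at hτim
  have hb0 : b ≠ 0 := by
    rintro rfl
    obtain ⟨z, hz, hne⟩ := him
    obtain ⟨n, hn⟩ := hgen z hz
    simp at hn; exact hne hn
  have hbpos : 0 < |b| := abs_pos.2 hb0
  refine ⟨τ, hτ, ?_, ?_⟩
  · by_contra hlt
    push Not at hlt
    have := hsmall τ hτ hτre (by rw [hτim, abs_abs, ← hτim]; exact hlt)
    rw [this] at hτim
    rw [← hτim] at hbpos
    simp at hbpos
  · intro z hz
    obtain ⟨n, hn⟩ := hgen z hz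
    have hw : z - n * τ ∈ Λ := Λ.sub_mem hz (by simpa using Λ.zsmul_mem hτ n)
    have hw2 : (z - n * τ) - (round (z - n * τ).re : ℤ) ∈ Λ := Λ.sub_mem hw (hintΛ _)
    have := hsmall _ hw2 (by
      rw [Complex.sub_re, Complex.intCast_re]; exact abs_sub_round _) (by simp [hτim, hn])
    refine ⟨n, round (z - n * τ).re, ?_⟩
    linear_combination this

lemma hasSum_two_to_one {A B : Type*} [Neg A] (e : A → B) (hs : Function.Surjective e)
    (he : ∀ p q, e p = e q ↔ p = q ∨ p = -q) (hne : ∀ p : A, p ≠ -p) (g : B → ℂ) (S : ℂ)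
    (h : HasSum (fun a => g (e a)) S) : HasSum g (S / 2) := by
  classical
  have h2 := h.tsum_fiberwise e
  have h3 : (fun c : B => ∑' b : e ⁻¹' {c}, g (e b)) = fun c => g c * 2 := by
    ext c
    obtain ⟨p, rfl⟩ := hs c
    have : e ⁻¹' {e p} = (({p, -p} : Finset A) : Set A) := by
      ext q
      have hpq : e q = e p ↔ q = p ∨ q = -p := he q p
      simp [hpq]
    rw [this, Finset.tsum_subtype' ({p, -p} : Finset A) (fun b => g (e b)), Finset.sum_pair (hne p),
      (he (-p) p).2 (Or.inr rfl)]
    ring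
  rw [h3] at h2
  have := h2.div_const 2
  simpa using this

section
variable {K : Type} [Field K] [NumberField K]
open scoped nonZeroDivisors

lemma exists_min (c : ClassGroup (𝓞 K)) : ∃ I : (Ideal (𝓞 K))⁰, ClassGroup.mk0 I = c ∧
    ∀ I' : (Ideal (𝓞 K))⁰, ClassGroup.mk0 I' = c →
      Ideal.absNorm (I : Ideal (𝓞 K)) ≤ Ideal.absNorm (I' : Ideal (𝓞 K)) := by
  obtain ⟨I0, h0⟩ := ClassGroup.mk0_surjective c
  obtain ⟨I, hI, hm⟩ := WellFounded.has_min (measure fun I : (Ideal (𝓞 K))⁰ =>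
    Ideal.absNorm (I : Ideal (𝓞 K))).wf {I | ClassGroup.mk0 I = c} ⟨I0, h0⟩
  exact ⟨I, hI, fun I' h' => not_lt.1 (hm I' h')⟩

noncomputable def minI (c : ClassGroup (𝓞 K)) : (Ideal (𝓞 K))⁰ := (exists_min c).choose

lemma minI_mk (c : ClassGroup (𝓞 K)) : ClassGroup.mk0 (minI c) = c := (exists_min c).choose_spec.1

lemma minI_min (c : ClassGroup (𝓞 K)) (I' : (Ideal (𝓞 K))⁰) (h : ClassGroup.mk0 I' = c) :
    Ideal.absNorm (minI c : Ideal (𝓞 K)) ≤ Ideal.absNorm (I' : Ideal (𝓞 K)) :=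
  (exists_min c).choose_spec.2 I' h

noncomputable abbrev nm (I : (Ideal (𝓞 K))⁰) : ℕ := Ideal.absNorm (I : Ideal (𝓞 K))

lemma nm_pos (I : (Ideal (𝓞 K))⁰) : 0 < nm I :=
  Nat.pos_of_ne_zero (Ideal.absNorm_ne_zero_of_nonZeroDivisors I)

namespace QD
variable (D : QD K)

lemma class_param (hd : D.d < -4) (c : ClassGroup (𝓞 K)) : ∃ u y : ℝ, 1 / 2 ≤ y ∧
    D.r / 2 ≤ nm (minI c) * y ∧
    ∃ e : {p : ℤ × ℤ // p ≠ 0} → {L : (Ideal (𝓞 K))⁰ // ClassGroup.mk0 L = c},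
      Function.Surjective e ∧ (∀ p q, e p = e q ↔ p.1 = q.1 ∨ p.1 = -q.1) ∧
      ∀ p, (nm (e p).1 : ℝ) =
        nm (minI c) * ((p.1.2 + p.1.1 * u) ^ 2 + (p.1.1 * y) ^ 2) := by
  set I := minI c with hI
  obtain ⟨J, hJ⟩ := ClassGroup.mk0_surjective c⁻¹
  have hprin : ∀ L : (Ideal (𝓞 K))⁰, ClassGroup.mk0 L = c →
      ∃ γ : 𝓞 K, γ ≠ 0 ∧ (L : Ideal (𝓞 K)) * J = Ideal.span {γ} := by
    intro L hL
    have h1 : ClassGroup.mk0 (L * J) = 1 := by rw [map_mul, hL, hJ, mul_inv_cancel]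
    have h2 := (ClassGroup.mk0_eq_one_iff (L * J).2).1 h1
    obtain ⟨γ, hγ⟩ := h2.principal
    have hγ' : (L : Ideal (𝓞 K)) * J = Ideal.span {γ} := by simpa using hγ
    refine ⟨γ, ?_, hγ'⟩
    rintro rfl
    have h3 := nonZeroDivisors.ne_zero (L * J).2
    apply h3
    simpa using hγ'
  obtain ⟨β, hβ0, hβ⟩ := hprin I (minI_mk c)
  have hex : ∀ γ : 𝓞 K, γ ≠ 0 → γ ∈ (J : Ideal (𝓞 K)) →
      ∃ L : {L : (Ideal (𝓞 K))⁰ // ClassGroup.mk0 L = c},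
        (L.1 : Ideal (𝓞 K)) * J = Ideal.span {γ} := by
    intro γ h0 hγ
    obtain ⟨L, hL⟩ := Ideal.dvd_span_singleton.2 hγ
    have hL0 : L ∈ (Ideal (𝓞 K))⁰ := by
      rw [mem_nonZeroDivisors_iff_ne_zero]
      rintro rfl
      rw [mul_zero] at hL
      exact h0 (by simpa using hL)
    refine ⟨⟨⟨L, hL0⟩, ?_⟩, by rw [mul_comm, hL]⟩
    have h1 : ClassGroup.mk0 (J * ⟨L, hL0⟩) = 1 := by
      rw [ClassGroup.mk0_eq_one_iff (J * ⟨L, hL0⟩).2]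
      exact ⟨γ, by simpa using hL.symm⟩
    rw [map_mul, hJ, inv_mul_eq_one] at h1
    exact h1.symm
  have hJpos : (0 : ℝ) < nm J := by exact_mod_cast nm_pos J
  have hφβ : D.φ β ≠ 0 := D.φ_ne hβ0
  have hnorm : ∀ (L : (Ideal (𝓞 K))⁰) (γ : 𝓞 K), (L : Ideal (𝓞 K)) * J = Ideal.span {γ} →
      (nm L : ℝ) = nm I * ‖D.φ γ / D.φ β‖ ^ 2 := by
    intro L γ h
    have h1 := D.absNorm_span γ
    have h2 := D.absNorm_span β
    rw [← h, map_mul] at h1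
    rw [← hβ, map_mul] at h2
    push_cast at h1 h2
    have h3 : ‖D.φ β‖ ≠ 0 := norm_ne_zero_iff.2 hφβ
    rw [norm_div, div_pow, ← h1, ← h2]
    have h4 : (nm I : ℝ) ≠ 0 := by exact_mod_cast (nm_pos I).ne'
    have h5 : (nm J : ℝ) ≠ 0 := hJpos.ne'
    field_simp
  -- the lattice
  let θ : 𝓞 K →+ ℂ :=
    { toFun := fun γ => D.φ γ / D.φ β
      map_zero' := by simp
      map_add' := fun x y => by simp [add_div] }
  have hθ : ∀ γ, θ γ = D.φ γ / D.φ β := fun _ => rfl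
  have hθinj : ∀ x y, θ x = θ y → x = y := by
    intro x y h
    rw [hθ, hθ, div_left_inj' hφβ] at h
    exact RingOfIntegers.ext (D.φ.injective h)
  have hβJ : β ∈ (J : Ideal (𝓞 K)) :=
    Ideal.dvd_span_singleton.1 (Dvd.intro_left _ hβ)
  have hθβ : θ β = 1 := div_self hφβ
  set Λ : AddSubgroup ℂ := (Submodule.toAddSubgroup (J : Ideal (𝓞 K))).map θ with hΛ
  have hmem : ∀ z, z ∈ Λ ↔ ∃ γ ∈ (J : Ideal (𝓞 K)), θ γ = z := by
    intro z; rw [hΛ, AddSubgroup.mem_map]; rfl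
  obtain ⟨τ, hτ, hτ2, hrep⟩ := lattice_basis Λ ((hmem _).2 ⟨β, hβJ, hθβ⟩) (by
    intro z hz hz0
    obtain ⟨γ, hγ, rfl⟩ := (hmem z).1 hz
    have hγ0 : γ ≠ 0 := by rintro rfl; simp at hz0
    obtain ⟨L, hL⟩ := hex γ hγ0 hγ
    have h1 := hnorm L.1 γ hL
    have h2 : (nm I : ℝ) ≤ nm L.1 := by exact_mod_cast minI_min c L.1 L.2
    have h3 : (0 : ℝ) < nm I := by exact_mod_cast nm_pos I
    rw [← hθ] at h1
    rw [h1] at h2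
    have h4 := norm_nonneg (θ γ)
    by_contra hlt
    push Not at hlt
    have : ‖θ γ‖ ^ 2 < 1 := by nlinarith
    nlinarith) (by
    have hαi : IsIntegral ℤ D.α := by
      have : IsIntegral ℤ (D.α ^ 2) := by rw [D.sq]; exact isIntegral_algebraMap (R := ℤ) (x := D.d)
      exact IsIntegral.of_pow (n := 2) (by norm_num) this
    obtain ⟨A, hA⟩ : ∃ A : 𝓞 K, (A : K) = D.α := ⟨⟨D.α, hαi⟩, rfl⟩
    refine ⟨θ (A * β), (hmem _).2 ⟨_, Ideal.mul_mem_left _ _ hβJ, rfl⟩, ?_⟩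
    have : θ (A * β) = D.r * Complex.I := by
      rw [hθ, show ((A * β : 𝓞 K) : K) = A * β from rfl, hA, map_mul, mul_div_assoc,
        div_self hφβ, mul_one]
      exact D.φ_α
    rw [this]
    simpa using D.r_pos.ne')
  obtain ⟨γ1, hγ1, hθ1⟩ := (hmem τ).1 hτ
  have hcomb : ∀ n m : ℤ, θ (m * β + n * γ1) = m + n * τ := by
    intro n m
    rw [map_add, ← zsmul_eq_mul, ← zsmul_eq_mul, map_zsmul, map_zsmul, hθβ, hθ1]
    simp
  have hτ0 : 0 < τ.im := by linarith
  have hcomb0 : ∀ p : ℤ × ℤ, p ≠ 0 → ((p.2 : 𝓞 K) * β + p.1 * γ1) ≠ 0 := by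
    intro p hp h0
    have := hcomb p.1 p.2
    rw [h0, map_zero] at this
    have him := congrArg Complex.im this
    have hre := congrArg Complex.re this
    simp at him hre
    have h1 : p.1 = 0 := by
      rcases him with h | h
      · exact h
      · exact absurd h hτ0.ne'
    rw [h1] at hre
    simp at hre
    exact hp (Prod.ext h1 (by exact_mod_cast hre.symm))
  have hcombJ : ∀ p : ℤ × ℤ, ((p.2 : 𝓞 K) * β + p.1 * γ1) ∈ (J : Ideal (𝓞 K)) := fun p =>
    Ideal.add_mem _ (Ideal.mul_mem_left _ _ hβJ) (Ideal.mul_mem_left _ _ hγ1)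
  choose e he using fun p : {p : ℤ × ℤ // p ≠ 0} => hex _ (hcomb0 p.1 p.2) (hcombJ p.1)
  have hcinj : ∀ p q : ℤ × ℤ, ((p.2 : 𝓞 K) * β + p.1 * γ1) = ((q.2 : 𝓞 K) * β + q.1 * γ1) →
      p = q := by
    intro p q h
    by_contra hne
    apply hcomb0 (p - q) (sub_ne_zero.2 hne)
    simp only [Prod.snd_sub, Prod.fst_sub]
    push_cast
    linear_combination h
  refine ⟨τ.re, τ.im, hτ2, ?_, e, ?_, ?_, ?_⟩
  · -- a * y ≥ r / 2
    have ha : ((nm I : ℕ) : 𝓞 K) ∈ (I : Ideal (𝓞 K)) := Ideal.absNorm_mem _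
    have hmul : ((nm I : ℕ) : 𝓞 K) * γ1 ∈ Ideal.span {β} := by
      rw [← hβ]; exact Ideal.mul_mem_mul ha hγ1
    obtain ⟨ω, hω⟩ := Ideal.mem_span_singleton.1 hmul
    have h1 : D.φ ω = nm I * τ := by
      rw [← hθ1, hθ]
      have := congrArg (fun x : 𝓞 K => D.φ x) hω
      simp only [map_mul] at this
      rw [map_natCast, map_natCast] at this
      field_simp
      rw [this]; ring
    obtain ⟨v, hv⟩ := D.int_im ω
    rw [h1] at hv
    simp at hv
    have hpos : (0 : ℝ) < nm I * τ.im := mul_pos (by exact_mod_cast nm_pos I) hτ0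
    rw [hv] at hpos ⊢
    have hr := D.r_pos
    have hv0 : (0 : ℝ) < v := by
      by_contra hle
      push Not at hle
      nlinarith
    have hv1 : (1 : ℝ) ≤ v := by
      have : (0 : ℤ) < v := by exact_mod_cast hv0
      exact_mod_cast this
    nlinarith
  · rintro ⟨L, hL⟩
    obtain ⟨γ, hγ0, hγ⟩ := hprin L hL
    have hγJ : γ ∈ (J : Ideal (𝓞 K)) := Ideal.dvd_span_singleton.1 (Dvd.intro_left _ hγ)
    obtain ⟨n, m, hnm⟩ := hrep (θ γ) ((hmem _).2 ⟨γ, hγJ, rfl⟩)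
    rw [← hcomb] at hnm
    have hγe := hθinj _ _ hnm
    have hne : ((n, m) : ℤ × ℤ) ≠ 0 := by
      intro h0
      have h1 : n = 0 := congrArg Prod.fst h0
      have h2 : m = 0 := congrArg Prod.snd h0
      rw [h1, h2] at hγe
      simp at hγe
      exact hγ0 hγe
    refine ⟨⟨(n, m), hne⟩, ?_⟩
    have h3 := he ⟨(n, m), hne⟩
    simp only at h3
    rw [← hγe, ← hγ] at h3
    apply Subtype.ext
    apply Subtype.ext
    exact mul_right_cancel₀ (nonZeroDivisors.ne_zero J.2) h3
  · intro p q
    constructor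
    · intro h
      have h1 := he p
      rw [h, he q, D.span_eq_iff hd] at h1
      rcases h1 with h1 | h1
      · left; exact (hcinj _ _ h1).symm
      · right
        have h2 := hcinj q.1 (-p.1) (by
          rw [h1]; simp only [Prod.snd_neg, Prod.fst_neg]; push_cast; ring)
        rw [h2, neg_neg]
    · intro h
      apply Subtype.ext
      apply Subtype.ext
      apply mul_right_cancel₀ (nonZeroDivisors.ne_zero J.2)
      rw [he, he, D.span_eq_iff hd]
      rcases h with h | h
      · left; rw [h]
      · right; rw [h]; simp only [Prod.snd_neg, Prod.fst_neg]; push_cast; ring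
  · intro p
    rw [hnorm _ _ (he p), ← hθ, hcomb, Complex.sq_norm, Complex.normSq_apply]
    simp
    left
    ring

end QD
end
end Mordell


namespace Mordell
open NumberField

section
variable {K : Type} [Field K] [NumberField K]
open scoped nonZeroDivisors
namespace QD
variable (D : QD K)

lemma class_hasSum (c : ClassGroup (𝓞 K)) (a u y : ℝ) (ha : 0 < a) (hy : 0 < y)
    (e : {p : ℤ × ℤ // p ≠ 0} → {L : (Ideal (𝓞 K))⁰ // ClassGroup.mk0 L = c})
    (hs : Function.Surjective e) (he : ∀ p q, e p = e q ↔ p.1 = q.1 ∨ p.1 = -q.1)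
    (hn : ∀ p, (nm (e p).1 : ℝ) = a * ((p.1.2 + p.1.1 * u) ^ 2 + (p.1.1 * y) ^ 2))
    (s : ℂ) (h1 : 1 < s.re) :
    HasSum (fun L : {L : (Ideal (𝓞 K))⁰ // ClassGroup.mk0 L = c} => (nm L.1 : ℂ) ^ (-s))
      ((a : ℂ) ^ (-s) * (2 * riemannZeta (2 * s) + Grem u y s) / 2) := by
  have hs0 : s ≠ 0 := by rintro rfl; simp at h1; linarith
  have h := (lat_hasSum hy u h1).mul_left ((a : ℂ) ^ (-s))
  have hsupp : Function.support (fun p => (a : ℂ) ^ (-s) * lat u y s p) ⊆ {p : ℤ × ℤ | p ≠ 0} := by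
    intro p hp
    rintro rfl
    apply hp
    simp [lat, hs0]
  rw [← hasSum_subtype_iff_of_support_subset hsupp] at h
  let _ : Neg {p : ℤ × ℤ // p ≠ 0} := ⟨fun p => ⟨-p.1, neg_ne_zero.2 p.2⟩⟩
  refine hasSum_two_to_one e hs (fun p q => ?_) (fun p hp => ?_) _ _ ?_
  · rw [he, Subtype.ext_iff, Subtype.ext_iff]; rfl
  · have : p.1 = -p.1 := congrArg Subtype.val hp
    exact p.2 (self_eq_neg.1 this)
  · have h' : HasSum (fun p : {p : ℤ × ℤ // p ≠ 0} => (a : ℂ) ^ (-s) * lat u y s p.1)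
        ((a : ℂ) ^ (-s) * (2 * riemannZeta (2 * s) + Grem u y s)) := h
    convert h' using 1
    ext p
    have hnn : 0 ≤ ((p.1.2 + p.1.1 * u) ^ 2 + (p.1.1 * y) ^ 2) := by positivity
    have h2 : (nm (e p).1 : ℂ) = ((a * ((p.1.2 + p.1.1 * u) ^ 2 + (p.1.1 * y) ^ 2) : ℝ) : ℂ) := by
      rw [← hn]; simp
    rw [h2, Complex.ofReal_mul, Complex.mul_cpow_ofReal_nonneg ha.le hnn]
    rfl

lemma zetaK_hasSum (hd : D.d < -4) : ∃ u y : ClassGroup (𝓞 K) → ℝ,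
    (∀ c, 1 / 2 ≤ y c ∧ D.r / 2 ≤ nm (minI c) * y c) ∧
    ∀ s : ℂ, 1 < s.re → HasSum (fun L : (Ideal (𝓞 K))⁰ => (nm L : ℂ) ^ (-s))
      ((∑ c, (nm (minI c) : ℂ) ^ (-s) * (2 * riemannZeta (2 * s) + Grem (u c) (y c) s)) / 2) := by
  choose u y hy hay e hs he hn using D.class_param hd
  refine ⟨u, y, fun c => ⟨hy c, hay c⟩, fun s h1 => ?_⟩
  classical
  have hc : ∀ c : ClassGroup (𝓞 K), HasSum (Set.indicator {L : (Ideal (𝓞 K))⁰ | ClassGroup.mk0 L = c}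
      (fun L => (nm L : ℂ) ^ (-s)))
      ((nm (minI c) : ℂ) ^ (-s) * (2 * riemannZeta (2 * s) + Grem (u c) (y c) s) / 2) := by
    intro c
    rw [← hasSum_subtype_iff_indicator]
    have := class_hasSum c (nm (minI c)) (u c) (y c) (by exact_mod_cast nm_pos _)
      (by linarith [hy c]) (e c) (hs c) (he c) (hn c) s h1
    rw [Complex.ofReal_natCast] at this
    exact this
  have := hasSum_sum (s := Finset.univ) (fun c _ => hc c)
  rw [← Finset.sum_div] at this
  convert this using 1
  ext L
  rw [Finset.sum_eq_single (ClassGroup.mk0 L)]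
  · rw [Set.indicator_of_mem]; rfl
  · intro c _ hne
    rw [Set.indicator_of_notMem]
    exact fun h => hne h.symm
  · simp

end QD
end
end Mordell


namespace Mordell
open NumberField

section
variable {K : Type} [Field K] [NumberField K]

/-- number of ideals of given norm -/
noncomputable def rI (K : Type) [Field K] [NumberField K] (n : ℕ) : ℕ :=
  Nat.card {I : Ideal (𝓞 K) // Ideal.absNorm I = n}

lemma ideal_eq_of_dvd {A B : Ideal (𝓞 K)} (h : A ∣ B) (hn : Ideal.absNorm A = Ideal.absNorm B)
    (h0 : Ideal.absNorm B ≠ 0) : A = B := by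
  obtain ⟨C, rfl⟩ := h
  rw [map_mul] at hn h0
  have : Ideal.absNorm C = 1 := by
    have h1 : Ideal.absNorm A ≠ 0 := left_ne_zero_of_mul h0
    exact (Nat.eq_of_mul_eq_mul_left (Nat.pos_of_ne_zero h1) (by rw [mul_one]; exact hn)).symm
  rw [Ideal.absNorm_eq_one_iff.1 this, Ideal.mul_top]

lemma isCoprime_of_norm {A B : Ideal (𝓞 K)}
    (h : Nat.Coprime (Ideal.absNorm A) (Ideal.absNorm B)) : IsCoprime A B := by
  rw [Ideal.isCoprime_iff_exists]
  have h2 := Nat.isCoprime_iff_coprime.2 h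
  obtain ⟨u, v, huv⟩ := h2
  refine ⟨(u : 𝓞 K) * (Ideal.absNorm A : ℕ), Ideal.mul_mem_left _ _ (Ideal.absNorm_mem A),
    (v : 𝓞 K) * (Ideal.absNorm B : ℕ), Ideal.mul_mem_left _ _ (Ideal.absNorm_mem B), ?_⟩
  exact_mod_cast congrArg (fun z : ℤ => (z : 𝓞 K)) huv

lemma absNorm_natCast (D : QD K) (m : ℕ) : Ideal.absNorm (Ideal.span {(m : 𝓞 K)}) = m ^ 2 := by
  have := D.absNorm_span (m : 𝓞 K)
  have h2 : ((Ideal.absNorm (Ideal.span {(m : 𝓞 K)}) : ℕ) : ℝ) = ((m ^ 2 : ℕ) : ℝ) := by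
    rw [this]; simp
  exact_mod_cast h2

lemma rI_mul (D : QD K) {m n : ℕ} (h : Nat.Coprime m n) (hm : m ≠ 0) (hn : n ≠ 0) :
    rI K (m * n) = rI K m * rI K n := by
  unfold rI
  rw [← Nat.card_prod]
  symm
  apply Nat.card_congr
  refine Equiv.ofBijective (fun AB : {I : Ideal (𝓞 K) // Ideal.absNorm I = m} ×
      {I : Ideal (𝓞 K) // Ideal.absNorm I = n} =>
    (⟨AB.1.1 * AB.2.1, by rw [map_mul, AB.1.2, AB.2.2]⟩ :
      {I : Ideal (𝓞 K) // Ideal.absNorm I = m * n})) ⟨?_, ?_⟩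
  · rintro ⟨⟨A, hA⟩, ⟨B, hB⟩⟩ ⟨⟨A', hA'⟩, ⟨B', hB'⟩⟩ hEq
    have hEq' : A * B = A' * B' := congrArg Subtype.val hEq
    have h1 : A = A' := by
      apply ideal_eq_of_dvd _ (hA.trans hA'.symm) (by rw [hA']; exact hm)
      have hc : IsCoprime A B' := isCoprime_of_norm (by rw [hA, hB']; exact h)
      exact hc.dvd_of_dvd_mul_right (Dvd.intro _ hEq')
    have h2 : B = B' := by
      apply ideal_eq_of_dvd _ (hB.trans hB'.symm) (by rw [hB']; exact hn)
      have hc : IsCoprime B A' := isCoprime_of_norm (by rw [hB, hA']; exact h.symm)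
      exact hc.dvd_of_dvd_mul_left (Dvd.intro_left _ hEq')
    subst h1; subst h2; rfl
  · rintro ⟨I, hI⟩
    set A := I ⊔ Ideal.span {(m : 𝓞 K)} with hA
    set B := I ⊔ Ideal.span {(n : 𝓞 K)} with hB
    have hmn : ((m : 𝓞 K) * n) ∈ I := by
      have := Ideal.absNorm_mem I
      rw [hI] at this
      exact_mod_cast this
    have htop : Ideal.span {(m : 𝓞 K)} ⊔ Ideal.span {(n : 𝓞 K)} = ⊤ := by
      have h1 : IsCoprime (Ideal.span {(m : 𝓞 K)}) (Ideal.span {(n : 𝓞 K)}) :=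
        isCoprime_of_norm (by
          rw [absNorm_natCast D, absNorm_natCast D]; exact Nat.Coprime.pow _ _ h)
      exact Ideal.isCoprime_iff_sup_eq.1 h1
    have hAB : A * B = I := by
      apply le_antisymm
      · rw [hA, hB, Ideal.sup_mul, Ideal.mul_sup, Ideal.mul_sup, Ideal.span_singleton_mul_span_singleton]
        refine sup_le (sup_le ?_ ?_) (sup_le ?_ ?_)
        · exact Ideal.mul_le_left
        · exact Ideal.mul_le_left
        · exact Ideal.mul_le_right
        rw [Ideal.span_singleton_le_iff_mem]; exact hmn
      · calc I = I * (Ideal.span {(m : 𝓞 K)} ⊔ Ideal.span {(n : 𝓞 K)}) := by rw [htop, Ideal.mul_top]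
          _ ≤ A * B := by
            rw [Ideal.mul_sup]
            refine sup_le ?_ ?_
            · rw [mul_comm]; exact Ideal.mul_mono le_sup_right le_sup_left
            · exact Ideal.mul_mono le_sup_left le_sup_right
    have hNA : Nat.Coprime (Ideal.absNorm A) n := by
      have h1 : Ideal.absNorm A ∣ m ^ 2 := by
        rw [← absNorm_natCast D]; exact Ideal.absNorm_dvd_absNorm_of_le le_sup_right
      exact Nat.Coprime.coprime_dvd_left h1 (Nat.Coprime.pow_left _ h)
    have hNB : Nat.Coprime (Ideal.absNorm B) m := by
      have h1 : Ideal.absNorm B ∣ n ^ 2 := by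
        rw [← absNorm_natCast D]; exact Ideal.absNorm_dvd_absNorm_of_le le_sup_right
      exact Nat.Coprime.coprime_dvd_left h1 (Nat.Coprime.pow_left _ h.symm)
    have hprod : Ideal.absNorm A * Ideal.absNorm B = m * n := by rw [← map_mul, hAB, hI]
    have h1 : Ideal.absNorm A ∣ m := hNA.dvd_of_dvd_mul_right (Dvd.intro _ hprod)
    have h2 : Ideal.absNorm B ∣ n := hNB.dvd_of_dvd_mul_left (Dvd.intro_left _ hprod)
    have h3 : m ∣ Ideal.absNorm A := hNB.symm.dvd_of_dvd_mul_right (Dvd.intro _ hprod.symm)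
    have h4 : n ∣ Ideal.absNorm B := hNA.symm.dvd_of_dvd_mul_left (Dvd.intro_left _ hprod.symm)
    exact ⟨⟨⟨A, Nat.dvd_antisymm h1 h3⟩, ⟨B, Nat.dvd_antisymm h2 h4⟩⟩, Subtype.ext hAB⟩

lemma rI_one : rI K 1 = 1 := by
  unfold rI
  rw [Nat.card_eq_one_iff_unique]
  refine ⟨⟨fun a b => Subtype.ext ?_⟩, ⟨⟨⊤, Ideal.absNorm_top⟩⟩⟩
  rw [Ideal.absNorm_eq_one_iff.1 a.2, Ideal.absNorm_eq_one_iff.1 b.2]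

/-! ### prime decomposition -/

lemma span_p_ne (p : ℕ) (hp : p.Prime) : Ideal.span {(p : 𝓞 K)} ≠ ⊥ := by
  rw [Ne, Ideal.span_singleton_eq_bot]
  exact_mod_cast hp.ne_zero

lemma prime_struct (D : QD K) (p : ℕ) (hp : p.Prime) :
    Prime (Ideal.span {(p : 𝓞 K)}) ∨ ∃ P Q : Ideal (𝓞 K), Prime P ∧ Prime Q ∧
      Ideal.absNorm P = p ∧ Ideal.absNorm Q = p ∧ Ideal.span {(p : 𝓞 K)} = P * Q := by
  by_cases hpr : Prime (Ideal.span {(p : 𝓞 K)})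
  · exact Or.inl hpr
  right
  have hN := absNorm_natCast D p
  have htop : Ideal.span {(p : 𝓞 K)} ≠ ⊤ := by
    intro h
    rw [h, Ideal.absNorm_top] at hN
    have := hp.one_lt
    nlinarith
  obtain ⟨P, hPm, hP⟩ := Ideal.exists_le_maximal _ htop
  obtain ⟨Q, hQ⟩ := Ideal.dvd_iff_le.2 hP
  have hP0 : P ≠ ⊥ := by
    rintro rfl
    exact span_p_ne p hp (le_bot_iff.1 hP)
  have hPp : Prime P := Ideal.prime_of_isPrime hP0 hPm.isPrime
  rw [hQ, map_mul] at hN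
  have hP1 : Ideal.absNorm P ≠ 1 := fun h => hPm.ne_top (Ideal.absNorm_eq_one_iff.1 h)
  have hQ1 : Ideal.absNorm Q ≠ 1 := by
    intro h
    rw [Ideal.absNorm_eq_one_iff.1 h, Ideal.mul_top] at hQ
    exact hpr (hQ ▸ hPp)
  obtain ⟨h1, h2⟩ := (hp.mul_eq_prime_sq_iff hP1 hQ1).1 hN
  have hQ0 : Q ≠ ⊥ := by
    rintro rfl
    rw [Ideal.absNorm_bot] at h2
    exact hp.ne_zero h2.symm
  have hQi : Q.IsPrime := Ideal.isPrime_of_irreducible_absNorm (by rw [h2]; exact hp)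
  exact ⟨P, Q, hPp, Ideal.prime_of_isPrime hQ0 hQi, h1, h2, hQ⟩

lemma peel (p : ℕ) (hp : p.Prime) (I : Ideal (𝓞 K)) (e : ℕ) (hI : Ideal.absNorm I = p ^ e)
    (he : e ≠ 0) : ∃ P I' : Ideal (𝓞 K), ∃ e' < e, Prime P ∧ P ∣ Ideal.span {(p : 𝓞 K)} ∧
      I = P * I' ∧ Ideal.absNorm I' = p ^ e' := by
  have htop : I ≠ ⊤ := by
    rintro rfl
    rw [Ideal.absNorm_top] at hI
    exact absurd hI.symm (Nat.one_lt_pow he hp.one_lt).ne'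
  obtain ⟨P, hPm, hP⟩ := Ideal.exists_le_maximal _ htop
  obtain ⟨I', hI'⟩ := Ideal.dvd_iff_le.2 hP
  rw [hI', map_mul] at hI
  obtain ⟨f, hf, hPf⟩ := (Nat.dvd_prime_pow hp).1 (Dvd.intro _ hI)
  obtain ⟨e', he', hIe⟩ := (Nat.dvd_prime_pow hp).1 (Dvd.intro_left _ hI)
  have hf0 : f ≠ 0 := by
    rintro rfl
    exact hPm.ne_top (Ideal.absNorm_eq_one_iff.1 (by simpa using hPf))
  have hP0 : P ≠ ⊥ := by
    rintro rfl
    rw [Ideal.absNorm_bot] at hPf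
    exact (pow_ne_zero f hp.ne_zero) hPf.symm
  refine ⟨P, I', e', ?_, Ideal.prime_of_isPrime hP0 hPm.isPrime, ?_, hI', hIe⟩
  · rw [hPf, hIe, ← pow_add] at hI
    have := Nat.pow_right_injective hp.two_le hI
    omega
  · rw [Ideal.dvd_span_singleton]
    have h1 := Ideal.absNorm_mem P
    rw [hPf] at h1
    push_cast at h1
    exact hPm.isPrime.mem_of_pow_mem _ h1

lemma prime_eq_of_dvd {P Q : Ideal (𝓞 K)} (hP : Prime P) (hQ : Prime Q) (h : P ∣ Q) : P = Q :=
  associated_iff_eq.1 ((hP.dvd_prime_iff_associated hQ).1 h)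

lemma inert_pow (p : ℕ) (hp : p.Prime) (h : Prime (Ideal.span {(p : 𝓞 K)})) (e : ℕ) :
    ∀ (I : Ideal (𝓞 K)), Ideal.absNorm I = p ^ e → ∃ k, I = Ideal.span {(p : 𝓞 K)} ^ k := by
  induction e using Nat.strong_induction_on with
  | _ e ih =>
    intro I hI
    by_cases he : e = 0
    · subst he
      exact ⟨0, by rw [pow_zero, Ideal.one_eq_top]; exact Ideal.absNorm_eq_one_iff.1 (by simpa using hI)⟩
    · obtain ⟨P, I', e', he', hP, hPd, hPI, hI'⟩ := peel p hp I e hI he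
      obtain ⟨k, hk⟩ := ih e' he' I' hI'
      exact ⟨k + 1, by rw [hPI, hk, prime_eq_of_dvd hP h hPd, pow_succ']⟩

lemma split_pow (p : ℕ) (hp : p.Prime) (P Q : Ideal (𝓞 K)) (hP : Prime P) (hQ : Prime Q)
    (h : Ideal.span {(p : 𝓞 K)} = P * Q) (e : ℕ) :
    ∀ (I : Ideal (𝓞 K)), Ideal.absNorm I = p ^ e → ∃ i j, I = P ^ i * Q ^ j := by
  induction e using Nat.strong_induction_on with
  | _ e ih =>
    intro I hI
    by_cases he : e = 0
    · subst he
      exact ⟨0, 0, by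
        rw [pow_zero, pow_zero, one_mul, Ideal.one_eq_top]
        exact Ideal.absNorm_eq_one_iff.1 (by simpa using hI)⟩
    · obtain ⟨P', I', e', he', hP', hPd, hPI, hI'⟩ := peel p hp I e hI he
      obtain ⟨i, j, hk⟩ := ih e' he' I' hI'
      rw [h] at hPd
      rcases hP'.dvd_or_dvd hPd with h1 | h1
      · exact ⟨i + 1, j, by rw [hPI, hk, prime_eq_of_dvd hP' hP h1, pow_succ', mul_assoc]⟩
      · exact ⟨i, j + 1, by rw [hPI, hk, prime_eq_of_dvd hP' hQ h1, pow_succ']; ring⟩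

lemma rI_inert (D : QD K) (p : ℕ) (hp : p.Prime) (h : Prime (Ideal.span {(p : 𝓞 K)})) (e : ℕ) :
    (rI K (p ^ e) : ℤ) = ∑ i ∈ Finset.range (e + 1), (-1) ^ i := by
  have hN := absNorm_natCast D p
  have key : ∀ I : Ideal (𝓞 K), Ideal.absNorm I = p ^ e → ∃ k, e = 2 * k ∧
      I = Ideal.span {(p : 𝓞 K)} ^ k := by
    intro I hI
    obtain ⟨k, hk⟩ := inert_pow p hp h e I hI
    refine ⟨k, ?_, hk⟩
    rw [hk, map_pow, hN, ← pow_mul] at hI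
    exact (Nat.pow_right_injective hp.two_le hI).symm
  rw [neg_one_geom_sum]
  unfold rI
  by_cases he : Even (e + 1)
  · rw [if_pos he]
    have : IsEmpty {I : Ideal (𝓞 K) // Ideal.absNorm I = p ^ e} := ⟨fun I => by
      obtain ⟨k, hk, -⟩ := key I.1 I.2
      rw [hk, Nat.even_add_one] at he
      exact he ⟨k, by ring⟩⟩
    simp
  · rw [if_neg he]
    rw [Nat.even_add_one, not_not] at he
    obtain ⟨k, hk⟩ := he
    have : Nat.card {I : Ideal (𝓞 K) // Ideal.absNorm I = p ^ e} = 1 := by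
      rw [Nat.card_eq_one_iff_unique]
      refine ⟨⟨fun a b => Subtype.ext ?_⟩,
        ⟨⟨Ideal.span {(p : 𝓞 K)} ^ k, by rw [map_pow, hN, ← pow_mul, hk]; congr 1; ring⟩⟩⟩
      obtain ⟨k1, h1, h2⟩ := key a.1 a.2
      obtain ⟨k2, h3, h4⟩ := key b.1 b.2
      rw [h2, h4, show k1 = k2 by omega]
    rw [this]; rfl

lemma rI_ram (p : ℕ) (hp : p.Prime) (P : Ideal (𝓞 K)) (hP : Prime P) (hN : Ideal.absNorm P = p)
    (h : Ideal.span {(p : 𝓞 K)} = P * P) (e : ℕ) :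
    (rI K (p ^ e) : ℤ) = ∑ i ∈ Finset.range (e + 1), 0 ^ i := by
  have key : ∀ I : Ideal (𝓞 K), Ideal.absNorm I = p ^ e → I = P ^ e := by
    intro I hI
    obtain ⟨i, j, hk⟩ := split_pow p hp P P hP hP h e I hI
    rw [← pow_add] at hk
    rw [hk, map_pow, hN] at hI
    rw [hk, Nat.pow_right_injective hp.two_le hI]
  have : rI K (p ^ e) = 1 := by
    unfold rI
    rw [Nat.card_eq_one_iff_unique]
    refine ⟨⟨fun a b => Subtype.ext ?_⟩, ⟨⟨P ^ e, by rw [map_pow, hN]⟩⟩⟩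
    rw [key a.1 a.2, key b.1 b.2]
  rw [this, Finset.sum_range_succ']
  simp

lemma rI_split (p : ℕ) (hp : p.Prime) (P Q : Ideal (𝓞 K)) (hP : Prime P) (hQ : Prime Q)
    (hN : Ideal.absNorm P = p) (hN' : Ideal.absNorm Q = p) (hne : P ≠ Q)
    (h : Ideal.span {(p : 𝓞 K)} = P * Q) (e : ℕ) :
    (rI K (p ^ e) : ℤ) = ∑ i ∈ Finset.range (e + 1), 1 ^ i := by
  have hlt : ∀ i j : ℕ, i < j → j ≤ e → P ^ i * Q ^ (e - i) ≠ P ^ j * Q ^ (e - j) := by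
    intro i j hij hje heq
    rw [show j = i + (j - i) by omega, pow_add, mul_assoc] at heq
    have h1 := mul_left_cancel₀ (pow_ne_zero i hP.ne_zero) heq
    have h2 : P ∣ Q ^ (e - i) := by
      rw [h1]
      exact Dvd.dvd.mul_right (dvd_pow_self _ (by omega)) _
    exact hne (prime_eq_of_dvd hP hQ (hP.dvd_of_dvd_pow h2))
  have : rI K (p ^ e) = e + 1 := by
    unfold rI
    rw [← Nat.card_fin (e + 1)]
    symm
    apply Nat.card_congr
    refine Equiv.ofBijective (fun i : Fin (e + 1) =>
      (⟨P ^ (i : ℕ) * Q ^ (e - i), by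
        rw [map_mul, map_pow, map_pow, hN, hN', ← pow_add]; congr 1; omega⟩ :
        {I : Ideal (𝓞 K) // Ideal.absNorm I = p ^ e})) ⟨?_, ?_⟩
    · intro i j hij
      have hij' : P ^ (i : ℕ) * Q ^ (e - i) = P ^ (j : ℕ) * Q ^ (e - j) := congrArg Subtype.val hij
      rcases lt_trichotomy (i : ℕ) j with h1 | h1 | h1
      · exact absurd hij' (hlt _ _ h1 (by omega))
      · exact Fin.ext h1
      · exact absurd hij'.symm (hlt _ _ h1 (by omega))
    · rintro ⟨I, hI⟩
      obtain ⟨i, j, hk⟩ := split_pow p hp P Q hP hQ h e I hI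
      have hI2 := hI
      rw [hk, map_mul, map_pow, map_pow, hN, hN', ← pow_add] at hI2
      have hij : i + j = e := Nat.pow_right_injective hp.two_le hI2
      refine ⟨⟨i, by omega⟩, Subtype.ext ?_⟩
      simp only
      rw [hk, show e - i = j by omega]
  rw [this]
  simp

/-! ### comparison with the Jacobi symbol -/

lemma exists_A (D : QD K) : ∃ A : 𝓞 K, (A : K) = D.α := by
  have hαi : IsIntegral ℤ D.α := by
    have : IsIntegral ℤ (D.α ^ 2) := by rw [D.sq]; exact isIntegral_algebraMap (R := ℤ) (x := D.d)
    exact IsIntegral.of_pow (n := 2) (by norm_num) this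
  exact ⟨⟨D.α, hαi⟩, rfl⟩

/-- the square root of `d` as an algebraic integer -/
noncomputable def QD.A (D : QD K) : 𝓞 K := (exists_A D).choose

lemma QD.A_coe (D : QD K) : (D.A : K) = D.α := (exists_A D).choose_spec

lemma QD.A_sq (D : QD K) : D.A ^ 2 = (D.d : 𝓞 K) := by
  apply RingOfIntegers.ext
  rw [show ((D.A ^ 2 : 𝓞 K) : K) = (D.A : K) ^ 2 from rfl, D.A_coe, D.sq]; simp

lemma QD.dvd_coord (D : QD K) (p : ℕ) (m n : ℤ)
    (h : (m + n * D.A : 𝓞 K) ∈ Ideal.span {(p : 𝓞 K)}) : (p : ℤ) ∣ 2 * n := by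
  obtain ⟨x, hx⟩ := Ideal.mem_span_singleton.1 h
  obtain ⟨v, hv⟩ := D.int_im x
  have h1 := congrArg (fun z : 𝓞 K => (D.φ (z : K)).im) hx
  simp only [map_add, map_mul, map_intCast, map_natCast, D.A_coe, D.φ_α] at h1
  simp [hv] at h1
  refine ⟨v, ?_⟩
  have hr := D.r_pos.ne'
  have h2 : ((2 * n : ℤ) : ℝ) = ((p * v : ℤ) : ℝ) := by
    push_cast
    apply mul_right_cancel₀ hr
    linear_combination 2 * h1
  exact_mod_cast h2

lemma QD.mem_int (P : Ideal (𝓞 K)) (hP : Prime P) (p : ℕ) (hp : p.Prime) (hpP : (p : 𝓞 K) ∈ P)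
    (m : ℤ) (hm : (m : 𝓞 K) ∈ P) : (p : ℤ) ∣ m := by
  by_contra hnd
  have hc : IsCoprime (p : ℤ) m := (Nat.prime_iff_prime_int.1 hp).coprime_iff_not_dvd.2 hnd
  obtain ⟨u, v, huv⟩ := hc
  have h1 : (1 : 𝓞 K) ∈ P := by
    have h2 : ((u : 𝓞 K) * (p : 𝓞 K) + v * m) ∈ P :=
      P.add_mem (P.mul_mem_left _ hpP) (P.mul_mem_left _ hm)
    have h3 : ((u : 𝓞 K) * (p : 𝓞 K) + v * m) = 1 := by
      exact_mod_cast congrArg (fun z : ℤ => (z : 𝓞 K)) huv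
    rwa [h3] at h2
  exact (Ideal.isPrime_of_prime hP).ne_top ((Ideal.eq_top_iff_one _).2 h1)

lemma QD.exists_root (D : QD K) (P : Ideal (𝓞 K)) (p : ℕ) (hp : p.Prime)
    (hN : Ideal.absNorm P = p) : ∃ b : ℤ, D.A - b ∈ P := by
  have hcard : Nat.card (𝓞 K ⧸ P) = p := by
    rw [← hN, Ideal.absNorm_apply, Submodule.cardQuot_apply]
  have hfin : Finite (𝓞 K ⧸ P) := Nat.finite_of_card_ne_zero (by rw [hcard]; exact hp.ne_zero)
  have := Fintype.ofFinite (𝓞 K ⧸ P)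
  have e := ZMod.ringEquivOfPrime (𝓞 K ⧸ P) hp (by rw [← hcard, Nat.card_eq_fintype_card])
  have : NeZero p := ⟨hp.ne_zero⟩
  refine ⟨((e.symm (Ideal.Quotient.mk P D.A)).val : ℤ), ?_⟩
  rw [← Ideal.Quotient.eq]
  have h1 : e ((e.symm (Ideal.Quotient.mk P D.A)).val : ZMod p) = Ideal.Quotient.mk P D.A := by
    rw [ZMod.natCast_zmod_val, RingEquiv.apply_symm_apply]
  rw [map_natCast] at h1
  rw [Int.cast_natCast, map_natCast, h1]

lemma exists_chi (D : QD K) (p : ℕ) (hp : p.Prime) : ∃ χ : ℤ, (χ = 0 ∨ χ = 1 ∨ χ = -1) ∧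
    (∀ e, (rI K (p ^ e) : ℤ) = ∑ i ∈ Finset.range (e + 1), χ ^ i) ∧
    (¬ (p : ℤ) ∣ 2 * D.d → χ = jacobiSym D.d p) := by
  have hpp := Nat.prime_iff_prime_int.1 hp
  have : Fact p.Prime := ⟨hp⟩
  have hJ : ¬ (p : ℤ) ∣ 2 * D.d → ((D.d : ℤ) : ZMod p) ≠ 0 := by
    intro hnd h0
    rw [ZMod.intCast_zmod_eq_zero_iff_dvd] at h0
    exact hnd (Dvd.dvd.mul_left h0 _)
  rcases prime_struct D p hp with h | ⟨P, Q, hP, hQ, hN, hN', h⟩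
  · refine ⟨-1, by simp, rI_inert D p hp h, fun hnd => ?_⟩
    rw [← jacobiSym.legendreSym.to_jacobiSym]
    symm
    rw [legendreSym.eq_neg_one_iff]
    rintro ⟨b, hb⟩
    have hb' : (p : ℤ) ∣ D.d - (b.val : ℤ) ^ 2 := by
      rw [← ZMod.intCast_zmod_eq_zero_iff_dvd]
      push_cast
      rw [ZMod.natCast_zmod_val, hb]; ring
    have hmem : (D.A - (b.val : ℤ)) * (D.A + (b.val : ℤ)) ∈ Ideal.span {(p : 𝓞 K)} := by
      obtain ⟨k, hk⟩ := hb'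
      rw [Ideal.mem_span_singleton]
      refine ⟨(k : 𝓞 K), ?_⟩
      have h3 : (D.d : 𝓞 K) - ((b.val : ℤ) : 𝓞 K) ^ 2 = (p : 𝓞 K) * k := by
        exact_mod_cast congrArg (fun z : ℤ => (z : 𝓞 K)) hk
      rw [← h3, ← D.A_sq]; ring
    have hprime := Ideal.isPrime_of_prime h
    have h2 : (p : ℤ) ∣ 2 := by
      rcases hprime.mem_or_mem hmem with h1 | h1
      · have := D.dvd_coord p (-(b.val : ℤ)) 1 (by
          convert h1 using 1; push_cast; ring)
        simpa using this
      · have := D.dvd_coord p (b.val : ℤ) 1 (by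
          convert h1 using 1; push_cast; ring)
        simpa using this
    exact hnd (Dvd.dvd.mul_right h2 _)
  · have hpP : (p : 𝓞 K) ∈ P := by
      rw [← Ideal.dvd_span_singleton, h]; exact dvd_mul_right _ _
    obtain ⟨b, hb⟩ := D.exists_root P p hp hN
    have hdb : (p : ℤ) ∣ D.d - b ^ 2 := by
      apply QD.mem_int P hP p hp hpP
      have := P.mul_mem_left (D.A + b) hb
      convert this using 1
      push_cast
      rw [← D.A_sq]; ring
    by_cases hPQ : P = Q
    · subst hPQ
      refine ⟨0, by simp, rI_ram p hp P hP hN h, fun hnd => ?_⟩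
      exfalso
      have h1 : (D.A - b) * (D.A - b) ∈ Ideal.span {(p : 𝓞 K)} := by
        rw [h]; exact Ideal.mul_mem_mul hb hb
      have h2 := D.dvd_coord p (D.d + b ^ 2) (-(2 * b)) (by
        convert h1 using 1
        push_cast
        rw [← D.A_sq]; ring)
      apply hnd
      have h3 : (p : ℤ) ∣ 4 * b := by
        rw [show 4 * b = -(2 * (-(2 * b))) by ring]
        exact (dvd_neg (a := (p : ℤ))).2 h2
      rcases hpp.dvd_or_dvd h3 with h4 | h4
      · have : (p : ℤ) ∣ 2 := by
          have : (p : ℤ) ∣ 2 * 2 := by simpa using h4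
          rcases hpp.dvd_or_dvd this with h5 | h5 <;> exact h5
        exact Dvd.dvd.mul_right this _
      · have : (p : ℤ) ∣ D.d := by
          have h5 := dvd_add hdb (Dvd.dvd.mul_right h4 b)
          rwa [show D.d - b ^ 2 + b * b = D.d by ring] at h5
        exact Dvd.dvd.mul_left this _
    · refine ⟨1, by simp, rI_split p hp P Q hP hQ hN hN' hPQ h, fun hnd => ?_⟩
      rw [← jacobiSym.legendreSym.to_jacobiSym]
      symm
      rw [legendreSym.eq_one_iff p (hJ hnd)]
      refine ⟨(b : ZMod p), ?_⟩
      have : ((D.d - b ^ 2 : ℤ) : ZMod p) = 0 := (ZMod.intCast_zmod_eq_zero_iff_dvd _ _).2 hdb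
      push_cast at this
      rw [← sub_eq_zero, ← this]; ring

end
end Mordell


namespace Mordell
open NumberField

lemma unit_odd {d : ℤ} (hd : d ≠ 0) (a : ZMod (4 * d.natAbs)) (ha : IsUnit a) : Odd a.val := by
  have : NeZero (4 * d.natAbs) := ⟨by have := Int.natAbs_ne_zero.2 hd; omega⟩
  have h := (ZMod.isUnit_iff_coprime a.val (4 * d.natAbs)).1 (by
    rw [ZMod.natCast_zmod_val]; exact ha)
  have h2 : Nat.Coprime a.val 2 :=
    Nat.Coprime.coprime_dvd_right ⟨2 * d.natAbs, by ring⟩ h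
  exact Nat.coprime_two_right.1 h2

open scoped Classical in
/-- the quadratic character attached to `d`, modulo `4 |d|` -/
noncomputable def quadChar (d : ℤ) (hd : d ≠ 0) : DirichletCharacter ℂ (4 * d.natAbs) where
  toFun a := if IsUnit a then ((jacobiSym d a.val : ℤ) : ℂ) else 0
  map_one' := by
    have h1 : 1 < 4 * d.natAbs := by have := Int.natAbs_ne_zero.2 hd; omega
    have : Fact (1 < 4 * d.natAbs) := ⟨h1⟩
    rw [if_pos isUnit_one, ZMod.val_one, jacobiSym.one_right]; simp
  map_mul' a b := by
    have : NeZero (4 * d.natAbs) := ⟨by have := Int.natAbs_ne_zero.2 hd; omega⟩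
    by_cases ha : IsUnit a
    · by_cases hb : IsUnit b
      · have hao := unit_odd hd a ha
        have hbo := unit_odd hd b hb
        have : NeZero a.val := ⟨by rintro h; rw [h] at hao; simp at hao⟩
        have : NeZero b.val := ⟨by rintro h; rw [h] at hbo; simp at hbo⟩
        rw [if_pos (ha.mul hb), if_pos ha, if_pos hb, ZMod.val_mul,
          ← jacobiSym.mod_right d (hao.mul hbo), jacobiSym.mul_right]
        push_cast; ring
      · rw [if_neg (fun h => hb (IsUnit.mul_iff.1 h).2), if_neg hb, mul_zero]
    · rw [if_neg (fun h => ha (IsUnit.mul_iff.1 h).1), if_neg ha, zero_mul]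
  map_nonunit' a ha := by simp [ha]

lemma quadChar_good {d : ℤ} (hd : d ≠ 0) (p : ℕ) (hp : p.Prime) (h : ¬ (p : ℤ) ∣ 2 * d) :
    quadChar d hd (p : ZMod (4 * d.natAbs)) = ((jacobiSym d p : ℤ) : ℂ) := by
  have hc : Nat.Coprime p (4 * d.natAbs) := by
    rw [hp.coprime_iff_not_dvd]
    intro h2
    apply h
    have h3 : (p : ℤ) ∣ 4 * d := by
      rw [← Int.dvd_natAbs, Int.natAbs_mul]
      exact_mod_cast h2
    rw [show (4 : ℤ) * d = 2 * (2 * d) by ring] at h3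
    rcases (Nat.prime_iff_prime_int.1 hp).dvd_or_dvd h3 with h4 | h4
    · exact Dvd.dvd.mul_right h4 _
    · exact h4
  have hu : IsUnit (p : ZMod (4 * d.natAbs)) := (ZMod.isUnit_iff_coprime _ _).2 hc
  have ho : Odd p := Nat.coprime_two_right.1
    (Nat.Coprime.coprime_dvd_right ⟨2 * d.natAbs, by ring⟩ hc)
  classical
  change (if IsUnit (p : ZMod (4 * d.natAbs)) then
    ((jacobiSym d (p : ZMod (4 * d.natAbs)).val : ℤ) : ℂ) else 0) = _
  rw [if_pos hu, ZMod.val_natCast, ← jacobiSym.mod_right d ho]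

lemma quadChar_bad {d : ℤ} (hd : d ≠ 0) (p : ℕ) (hp : p.Prime) (h : (p : ℤ) ∣ 2 * d) :
    quadChar d hd (p : ZMod (4 * d.natAbs)) = 0 := by
  apply MulChar.map_nonunit
  rw [ZMod.isUnit_iff_coprime, hp.coprime_iff_not_dvd, not_not]
  have h3 : (p : ℤ) ∣ 4 * d := by
    rw [show (4 : ℤ) * d = 2 * (2 * d) by ring]; exact Dvd.dvd.mul_left h _
  rw [← Int.dvd_natAbs, Int.natAbs_mul] at h3
  exact_mod_cast h3

lemma norm_prime_cpow_lt (p : ℕ) (hp : p.Prime) {s : ℂ} (hs : 0 < s.re) : ‖(p : ℂ) ^ (-s)‖ < 1 := by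
  rw [Complex.norm_natCast_cpow_of_pos hp.pos]
  exact Real.rpow_lt_one_of_one_lt_of_neg (by exact_mod_cast hp.one_lt) (by simpa using hs)

lemma norm_chi_mul {χ : ℤ} (hχ : χ = 0 ∨ χ = 1 ∨ χ = -1) {x : ℂ} (hx : ‖x‖ < 1) :
    ‖(χ : ℂ) * x‖ < 1 := by
  rcases hχ with h | h | h <;> simp [h, hx]

lemma one_sub_ne {z : ℂ} (h : ‖z‖ < 1) : 1 - z ≠ 0 := by
  intro h0
  rw [← sub_eq_zero.1 h0] at h
  simp at h

section
variable {K : Type} [Field K] [NumberField K]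
open scoped nonZeroDivisors

lemma hasSum_rI (s : ℂ) (hs0 : s ≠ 0) (S : ℂ)
    (h : HasSum (fun L : (Ideal (𝓞 K))⁰ => (nm L : ℂ) ^ (-s)) S) :
    HasSum (fun n : ℕ => (rI K n : ℂ) * (n : ℂ) ^ (-s)) S := by
  have h2 := h.tsum_fiberwise (fun L : (Ideal (𝓞 K))⁰ => nm L)
  refine (congrArg (fun f => HasSum f S) (funext fun n => ?_)).mpr h2
  have h3 : ∀ b : (fun L : (Ideal (𝓞 K))⁰ => nm L) ⁻¹' {n}, (nm b.1 : ℂ) ^ (-s) = (n : ℂ) ^ (-s) := by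
    intro b
    have : nm b.1 = n := b.2
    rw [this]
  rw [tsum_congr h3, tsum_const, nsmul_eq_mul]
  by_cases hn : n = 0
  · subst hn; simp [hs0]
  · congr 2
    unfold rI
    apply Nat.card_congr
    refine ⟨fun I => ⟨⟨I.1, ?_⟩, I.2⟩, fun L => ⟨L.1.1, L.2⟩, fun _ => rfl, fun _ => rfl⟩
    rw [mem_nonZeroDivisors_iff_ne_zero]
    intro h0
    apply hn
    rw [← I.2, h0]
    simp

lemma local_factor (p : ℕ) (hp : p.Prime) (χ : ℤ) (hχ : χ = 0 ∨ χ = 1 ∨ χ = -1)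
    (hr : ∀ e, (rI K (p ^ e) : ℤ) = ∑ i ∈ Finset.range (e + 1), χ ^ i) {s : ℂ} (hs : 0 < s.re) :
    ∑' e : ℕ, (rI K (p ^ e) : ℂ) * ((p ^ e : ℕ) : ℂ) ^ (-s) =
      (1 - (p : ℂ) ^ (-s))⁻¹ * (1 - χ * (p : ℂ) ^ (-s))⁻¹ := by
  set x := (p : ℂ) ^ (-s) with hx
  have hx1 : ‖x‖ < 1 := norm_prime_cpow_lt p hp hs
  have hcx := norm_chi_mul hχ hx1
  rw [mul_comm, ← tsum_geometric_of_norm_lt_one hcx, ← tsum_geometric_of_norm_lt_one hx1,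
    tsum_mul_tsum_eq_tsum_sum_range_of_summable_norm]
  · apply tsum_congr
    intro e
    have h1 : (rI K (p ^ e) : ℂ) = ∑ i ∈ Finset.range (e + 1), (χ : ℂ) ^ i := by
      have := congrArg (fun z : ℤ => (z : ℂ)) (hr e)
      push_cast at this
      exact this
    have h2 : ((p ^ e : ℕ) : ℂ) ^ (-s) = x ^ e := by
      rw [hx, Nat.cast_pow, ← Complex.natCast_cpow_natCast_mul, mul_comm,
        Complex.cpow_mul_nat]
    rw [h1, h2, Finset.sum_mul]
    apply Finset.sum_congr rfl
    intro i hi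
    rw [mul_pow, mul_assoc, ← pow_add]
    have := Finset.mem_range.1 hi
    congr 2
    omega
  · exact (summable_geometric_of_norm_lt_one hcx).norm
  · exact (summable_geometric_of_norm_lt_one hx1).norm

lemma zetaK_factor (D : QD K) (hd : D.d < -4) : ∃ M : ℂ → ℂ,
    (∀ s : ℂ, 1 / 2 < s.re → s ≠ 1 → DifferentiableAt ℂ M s) ∧
    ∀ s : ℂ, 1 < s.re → HasSum (fun L : (Ideal (𝓞 K))⁰ => (nm L : ℂ) ^ (-s))
      (riemannZeta s * M s) := by
  have hd0 : D.d ≠ 0 := by omega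
  have : NeZero (4 * D.d.natAbs) := ⟨by have := Int.natAbs_ne_zero.2 hd0; omega⟩
  choose χ hχ hr hJ using exists_chi D
  obtain ⟨B, hmemB⟩ : ∃ B : Finset Nat.Primes, ∀ p : Nat.Primes, p ∈ B ↔ ((p : ℕ) : ℤ) ∣ 2 * D.d := by
    have hfin : {p : Nat.Primes | ((p : ℕ) : ℤ) ∣ 2 * D.d}.Finite := by
      refine Set.Finite.of_finite_image (f := fun p : Nat.Primes => (p : ℕ)) ?_
        (Nat.Primes.coe_nat_injective.injOn)
      refine (Nat.divisors (2 * D.d).natAbs).finite_toSet.subset ?_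
      rintro _ ⟨p, hp, rfl⟩
      rw [Finset.mem_coe, Nat.mem_divisors, ← Int.natCast_dvd]
      exact ⟨hp, by simpa using hd0⟩
    exact ⟨hfin.toFinset, fun p => by rw [Set.Finite.mem_toFinset]; rfl⟩
  refine ⟨fun s => DirichletCharacter.LFunction (quadChar D.d hd0) s *
    ∏ p ∈ B, (1 - (χ p p.2 : ℂ) * (p : ℂ) ^ (-s))⁻¹, ?_, ?_⟩
  · intro s hs hs1
    refine (DirichletCharacter.differentiableAt_LFunction _ _ (Or.inl hs1)).mul ?_
    apply DifferentiableAt.fun_finsetProd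
    intro p _
    apply DifferentiableAt.inv
    · refine (differentiableAt_const _).sub (DifferentiableAt.const_mul ?_ _)
      exact DifferentiableAt.const_cpow (by fun_prop) (Or.inl (by exact_mod_cast p.2.ne_zero))
    · exact one_sub_ne (norm_chi_mul (hχ p p.2) (norm_prime_cpow_lt p p.2 (by linarith)))
  · intro s hs
    obtain ⟨u, y, -, hsum⟩ := D.zetaK_hasSum hd
    have hsum := hsum s hs
    have hs0 : s ≠ 0 := by rintro rfl; simp at hs; linarith
    have hspos : 0 < s.re := by linarith
    have h1 := hasSum_rI s hs0 _ hsum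
    have hE := EulerProduct.eulerProduct_hasProd (f := fun n : ℕ => (rI K n : ℂ) * (n : ℂ) ^ (-s))
      (by simp [rI_one]) (by
        intro m n hmn
        by_cases hm : m = 0
        · subst hm; simp [hs0]
        by_cases hn : n = 0
        · subst hn; simp [hs0]
        rw [rI_mul D hmn hm hn, Nat.cast_mul, Nat.cast_mul, Complex.natCast_mul_natCast_cpow]
        ring) h1.summable.norm (by simp [hs0])
    rw [h1.tsum_eq] at hE
    have hζ := riemannZeta_eulerProduct_hasProd hs
    have hL := DirichletCharacter.LSeries_eulerProduct_hasProd (quadChar D.d hd0) hs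
    rw [← DirichletCharacter.LFunction_eq_LSeries _ hs] at hL
    have hF : HasProd (fun p : Nat.Primes => if p ∈ B then (1 - (χ p p.2 : ℂ) * (p : ℂ) ^ (-s))⁻¹ else 1)
        (∏ p ∈ B, if p ∈ B then (1 - (χ p p.2 : ℂ) * (p : ℂ) ^ (-s))⁻¹ else 1) :=
      hasProd_prod_of_ne_finset_one (fun p hp => by rw [if_neg hp])
    have hF2 : (∏ p ∈ B, if p ∈ B then (1 - (χ p p.2 : ℂ) * (p : ℂ) ^ (-s))⁻¹ else 1) =
        ∏ p ∈ B, (1 - (χ p p.2 : ℂ) * (p : ℂ) ^ (-s))⁻¹ :=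
      Finset.prod_congr rfl (fun p hp => by rw [if_pos hp])
    rw [hF2] at hF
    have hall := hζ.mul (hL.mul hF)
    have heq : ∀ p : Nat.Primes, ∑' e : ℕ, (rI K ((p : ℕ) ^ e) : ℂ) * (((p : ℕ) ^ e : ℕ) : ℂ) ^ (-s) =
        (1 - (p : ℂ) ^ (-s))⁻¹ * ((1 - quadChar D.d hd0 (p : ℕ) * (p : ℂ) ^ (-s))⁻¹ *
          if p ∈ B then (1 - (χ p p.2 : ℂ) * (p : ℂ) ^ (-s))⁻¹ else 1) := by
      intro p
      rw [local_factor p p.2 (χ p p.2) (hχ p p.2) (hr p p.2) hspos]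
      congr 1
      by_cases hp : p ∈ B
      · rw [if_pos hp, quadChar_bad hd0 p p.2 ((hmemB p).1 hp)]; simp
      · have hp' := fun h => hp ((hmemB p).2 h)
        rw [if_neg hp, mul_one, quadChar_good hd0 p p.2 hp', hJ p p.2 hp']
    have := hE.unique (by convert hall using 1; ext p; exact heq p)
    rw [this] at hsum
    exact hsum

end
end Mordell


namespace Mordell
open NumberField

section
variable {K : Type} [Field K] [NumberField K]
open scoped nonZeroDivisors

/-- ideals not divisible by any rational prime -/
def prim (I : Ideal (𝓞 K)) : Prop := ∀ p : ℕ, p.Prime → ¬ Ideal.span {(p : 𝓞 K)} ∣ I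

lemma prim.ne_zero {I : Ideal (𝓞 K)} (h : prim I) : I ≠ 0 := by
  rintro rfl
  exact h 2 Nat.prime_two (dvd_zero _)

lemma prim.mem {I : Ideal (𝓞 K)} (h : prim I) : I ∈ (Ideal (𝓞 K))⁰ :=
  mem_nonZeroDivisors_iff_ne_zero.2 h.ne_zero

lemma span_natAbs (k : ℤ) : Ideal.span {((k.natAbs : ℕ) : 𝓞 K)} = Ideal.span {(k : 𝓞 K)} := by
  rcases Int.natAbs_eq k with h | h
  · conv_rhs => rw [h]
    simp
  · conv_rhs => rw [h]
    rw [Int.cast_neg, Ideal.span_singleton_neg]; simp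

lemma prim.int {I : Ideal (𝓞 K)} (h : prim I) (k : ℤ) (hk : Ideal.span {(k : 𝓞 K)} ∣ I) :
    k.natAbs = 1 := by
  by_contra h1
  obtain ⟨p, hp, hpk⟩ := Nat.exists_prime_and_dvd h1
  apply h p hp
  refine dvd_trans ?_ hk
  rw [← span_natAbs]
  obtain ⟨m, hm⟩ := hpk
  rw [hm, Nat.cast_mul, ← Ideal.span_singleton_mul_span_singleton]
  exact dvd_mul_right _ _

lemma minI_prim (D : QD K) (c : ClassGroup (𝓞 K)) : prim (minI c : Ideal (𝓞 K)) := by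
  intro p hp hdvd
  obtain ⟨I', hI'⟩ := hdvd
  have h0 : I' ≠ 0 := by
    rintro rfl
    exact nonZeroDivisors.ne_zero (minI c).2 (by rw [hI', mul_zero])
  have hm : I' ∈ (Ideal (𝓞 K))⁰ := mem_nonZeroDivisors_iff_ne_zero.2 h0
  have hc : ClassGroup.mk0 ⟨I', hm⟩ = c := by
    rw [← minI_mk c, ClassGroup.mk0_eq_mk0_iff]
    refine ⟨(p : 𝓞 K), 1, by exact_mod_cast hp.ne_zero, one_ne_zero, ?_⟩
    simp [hI', Ideal.span_singleton_one]
  have h1 := minI_min c ⟨I', hm⟩ hc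
  rw [hI', map_mul, absNorm_natCast D] at h1
  have h2 := nm_pos (⟨I', hm⟩ : (Ideal (𝓞 K))⁰)
  have h3 := hp.two_le
  change p ^ 2 * Ideal.absNorm I' ≤ Ideal.absNorm I' at h1
  change 0 < Ideal.absNorm I' at h2
  have h4 : 4 ≤ p ^ 2 := by nlinarith
  nlinarith

lemma prim_eq_minI (D : QD K) (I : Ideal (𝓞 K)) (h : prim I)
    (hY : (Ideal.absNorm I : ℝ) < D.r / 2) :
    (minI (ClassGroup.mk0 ⟨I, h.mem⟩) : Ideal (𝓞 K)) = I := by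
  set c := ClassGroup.mk0 ⟨I, h.mem⟩ with hc
  set I0 : Ideal (𝓞 K) := (minI c : Ideal (𝓞 K)) with hI0
  obtain ⟨x, y, hx, hy, hxy⟩ := ClassGroup.mk0_eq_mk0_iff.1 (hc.symm.trans (minI_mk c).symm)
  simp only at hxy
  set n := Ideal.absNorm I with hn
  set n0 := Ideal.absNorm I0 with hn0
  have hle : n0 ≤ n := minI_min c ⟨I, h.mem⟩ rfl
  have hnpos : 0 < n := nm_pos (⟨I, h.mem⟩ : (Ideal (𝓞 K))⁰)
  have hn0pos : 0 < n0 := nm_pos (minI c)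
  have hmem : x * (n : 𝓞 K) ∈ Ideal.span {y} * I0 := by
    rw [← hxy]
    exact Ideal.mul_mem_mul (Ideal.mem_span_singleton_self x) (Ideal.absNorm_mem I)
  obtain ⟨ω, hω, hωe⟩ := Ideal.mem_span_singleton_mul.1 hmem
  have hN : ‖D.φ x‖ ^ 2 * n = ‖D.φ y‖ ^ 2 * n0 := by
    have := congrArg (fun J => (Ideal.absNorm J : ℝ)) hxy
    simp only [map_mul] at this
    push_cast at this
    rw [D.absNorm_span, D.absNorm_span] at this
    exact this
  have hφx : ‖D.φ x‖ ≠ 0 := norm_ne_zero_iff.2 (D.φ_ne hx)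
  have hφy : ‖D.φ y‖ ≠ 0 := norm_ne_zero_iff.2 (D.φ_ne hy)
  have hωn : ‖D.φ ω‖ ^ 2 = n0 * n := by
    have h1 := congrArg (fun z : 𝓞 K => ‖D.φ (z : K)‖ ^ 2) hωe
    simp only [map_mul, map_natCast, norm_mul, Complex.norm_natCast, mul_pow] at h1
    have : ‖D.φ y‖ ^ 2 * ‖D.φ ω‖ ^ 2 = ‖D.φ y‖ ^ 2 * (n0 * n) := by
      rw [h1]; linear_combination (n : ℝ) * hN
    exact mul_left_cancel₀ (pow_ne_zero 2 hφy) this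
  have hωs : ‖D.φ ω‖ < D.r / 2 := by
    refine lt_of_le_of_lt ?_ hY
    have h1 : (n0 : ℝ) ≤ n := by exact_mod_cast hle
    have h2 : (0 : ℝ) ≤ n := by positivity
    apply le_of_sq_le_sq _ h2
    rw [hωn]; nlinarith
  obtain ⟨m, hm⟩ := D.int_of_small ω ((Complex.abs_im_le_norm _).trans_lt hωs)
  subst hm
  have hm0 : m ≠ 0 := by
    rintro rfl
    simp at hωn
    omega
  have hmI : Ideal.span {(m : 𝓞 K)} * I = Ideal.span {(n : 𝓞 K)} * I0 := by
    have h1 : Ideal.span {y} * (Ideal.span {(m : 𝓞 K)} * I) =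
        Ideal.span {y} * (Ideal.span {(n : 𝓞 K)} * I0) := by
      rw [← mul_assoc, Ideal.span_singleton_mul_span_singleton, hωe,
        ← Ideal.span_singleton_mul_span_singleton, mul_comm (Ideal.span {x}), mul_assoc, hxy]
      ring
    exact mul_left_cancel₀ (by simpa using hy) h1
  obtain ⟨g, m', n', hg, hcop, hm', hn'⟩ := Int.exists_gcd_one' (m := m) (n := (n : ℤ))
    (Int.gcd_pos_of_ne_zero_left _ hm0)
  have hg0 : Ideal.span {(g : 𝓞 K)} ≠ 0 := by
    have : (g : 𝓞 K) ≠ 0 := by exact_mod_cast hg.ne'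
    simpa using this
  have hmn' : Ideal.span {(m' : 𝓞 K)} * I = Ideal.span {(n' : 𝓞 K)} * I0 := by
    have hn'' : (n : 𝓞 K) = (n' : 𝓞 K) * g := by
      exact_mod_cast congrArg (fun z : ℤ => (z : 𝓞 K)) hn'
    have hm'' : (m : 𝓞 K) = (m' : 𝓞 K) * g := by
      exact_mod_cast congrArg (fun z : ℤ => (z : 𝓞 K)) hm'
    rw [hn'', hm'', ← Ideal.span_singleton_mul_span_singleton,
      ← Ideal.span_singleton_mul_span_singleton, mul_comm _ (Ideal.span {(g : 𝓞 K)}),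
      mul_comm _ (Ideal.span {(g : 𝓞 K)}), mul_assoc, mul_assoc] at hmI
    exact mul_left_cancel₀ hg0 hmI
  have hdv : Ideal.span {(n' : 𝓞 K)} ∣ I := by
    have hc2 : IsCoprime (Ideal.span {(n' : 𝓞 K)}) (Ideal.span {(m' : 𝓞 K)}) := by
      rw [Ideal.isCoprime_span_singleton_iff]
      have := (Int.isCoprime_iff_gcd_eq_one.2 hcop).symm
      exact_mod_cast this.map (Int.castRingHom (𝓞 K))
    exact hc2.dvd_of_dvd_mul_left (Dvd.intro _ hmn'.symm)
  have hn1 := h.int n' hdv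
  have htop : Ideal.span {(n' : 𝓞 K)} = ⊤ := by
    rw [← span_natAbs, hn1]; simp
  rw [htop, Ideal.top_mul] at hmn'
  apply (ideal_eq_of_dvd (Dvd.intro_left _ hmn') _ hn0pos.ne').symm
  apply le_antisymm _ hle
  have h5 := congrArg Ideal.absNorm hmn'
  rw [map_mul] at h5
  exact Nat.le_of_dvd hn0pos (Dvd.intro_left _ h5)

/-- class of an ideal -/
noncomputable def cl (I : Ideal (𝓞 K)) : ClassGroup (𝓞 K) :=
  open scoped Classical in if h : I ∈ (Ideal (𝓞 K))⁰ then ClassGroup.mk0 ⟨I, h⟩ else 1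

lemma minI_cl (D : QD K) (I : Ideal (𝓞 K)) (h : prim I)
    (hY : (Ideal.absNorm I : ℝ) < D.r / 2) : (minI (cl I) : Ideal (𝓞 K)) = I := by
  have : cl I = ClassGroup.mk0 ⟨I, h.mem⟩ := dif_pos h.mem
  rw [this]
  exact prim_eq_minI D I h hY

lemma card_prim (D : QD K) (F : Finset (Ideal (𝓞 K))) (h : ∀ I ∈ F, prim I)
    (hY : ∀ I ∈ F, (Ideal.absNorm I : ℝ) < D.r / 2) : F.card ≤ classNumber K := by
  classical
  unfold classNumber
  rw [← Finset.card_univ]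
  apply Finset.card_le_card_of_injOn cl (fun _ _ => Finset.mem_coe.2 (Finset.mem_univ _))
  intro I hI J hJ hIJ
  rw [← minI_cl D I (h I hI) (hY I hI), ← minI_cl D J (h J hJ) (hY J hJ), hIJ]

end
end Mordell


namespace Mordell
open NumberField

section
variable {K : Type} [Field K] [NumberField K]
open scoped nonZeroDivisors

lemma exists_prime_below (P : Ideal (𝓞 K)) (hP : Prime P) :
    ∃ p : ℕ, p.Prime ∧ P ∣ Ideal.span {(p : 𝓞 K)} := by
  have hi := Ideal.isPrime_of_prime hP
  have h0 : Ideal.absNorm P ≠ 0 := by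
    rw [Ne, Ideal.absNorm_eq_zero_iff]; exact hP.ne_zero
  have key : ∀ n : ℕ, n ≠ 0 → (n : 𝓞 K) ∈ P → ∃ p : ℕ, p.Prime ∧ (p : 𝓞 K) ∈ P := by
    intro n
    induction n using Nat.recOnMul with
    | zero => intro h; exact absurd rfl h
    | one =>
      intro _ h
      exact absurd ((Ideal.eq_top_iff_one _).2 (by simpa using h)) hi.ne_top
    | prime p hp => exact fun _ h => ⟨p, hp, h⟩
    | mul a b iha ihb =>
      intro hab h
      rw [Nat.cast_mul] at h
      rcases hi.mem_or_mem h with h1 | h1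
      · exact iha (left_ne_zero_of_mul hab) h1
      · exact ihb (right_ne_zero_of_mul hab) h1
  obtain ⟨p, hp, hm⟩ := key _ h0 (Ideal.absNorm_mem P)
  exact ⟨p, hp, Ideal.dvd_span_singleton.2 hm⟩

lemma absNorm_dvd {A B : Ideal (𝓞 K)} (h : A ∣ B) : Ideal.absNorm A ∣ Ideal.absNorm B :=
  Ideal.absNorm_dvd_absNorm_of_le (Ideal.le_of_dvd h)

/-- a ramified prime ideal -/
def ram (P : Ideal (𝓞 K)) : Prop := Prime P ∧ (Ideal.absNorm P).Prime ∧
  Ideal.span {((Ideal.absNorm P : ℕ) : 𝓞 K)} = P * P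

lemma split_prim (D : QD K) (p : ℕ) (hp : p.Prime) (P Q : Ideal (𝓞 K)) (hP : Prime P)
    (hQ : Prime Q) (hN : Ideal.absNorm P = p) (h : Ideal.span {(p : 𝓞 K)} = P * Q) (hne : P ≠ Q)
    (k : ℕ) : prim (P ^ k) := by
  intro q hq hdvd
  have h1 := absNorm_dvd hdvd
  rw [absNorm_natCast D, map_pow, hN] at h1
  have h2 : q = p := (Nat.prime_dvd_prime_iff_eq hq hp).1
    (hq.dvd_of_dvd_pow (dvd_trans (dvd_pow_self q two_ne_zero) h1))
  rw [h2, h] at hdvd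
  have h3 : Q ∣ P ^ k := dvd_trans (dvd_mul_left _ _) hdvd
  exact hne (prime_eq_of_dvd hQ hP (hQ.dvd_of_dvd_pow h3)).symm

lemma no_split (D : QD K) (Z : ℝ) (hZ : 1 < Z) (hZY : Z ^ (classNumber K + 1) ≤ D.r / 2)
    (p : ℕ) (hp : p.Prime) (hpZ : (p : ℝ) < Z) (P Q : Ideal (𝓞 K)) (hP : Prime P)
    (hQ : Prime Q) (hN : Ideal.absNorm P = p) (h : Ideal.span {(p : 𝓞 K)} = P * Q) : P = Q := by
  classical
  by_contra hne
  have hinj : Function.Injective (fun k : ℕ => P ^ k) := by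
    intro i j hij
    have := congrArg Ideal.absNorm hij
    simp only [map_pow, hN] at this
    exact Nat.pow_right_injective hp.two_le this
  have := card_prim D ((Finset.range (classNumber K + 1)).image (fun k : ℕ => P ^ k)) (by
    intro I hI
    obtain ⟨k, -, rfl⟩ := Finset.mem_image.1 hI
    exact split_prim D p hp P Q hP hQ hN h hne k) (by
    intro I hI
    obtain ⟨k, hk, rfl⟩ := Finset.mem_image.1 hI
    have hk' := Finset.mem_range.1 hk
    rw [map_pow, hN]
    push_cast
    calc (p : ℝ) ^ k ≤ Z ^ k := by gcongr
      _ < Z ^ (classNumber K + 1) := pow_lt_pow_right₀ hZ hk'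
      _ ≤ _ := hZY)
  rw [Finset.card_image_of_injective _ hinj, Finset.card_range] at this
  omega

lemma small_ram (D : QD K) (Z : ℝ) (hZ : 1 < Z) (hZY : Z ^ (classNumber K + 1) ≤ D.r / 2)
    (I : Ideal (𝓞 K)) (hI : prim I) (hIZ : (Ideal.absNorm I : ℝ) < Z) (P : Ideal (𝓞 K))
    (hP : Prime P) (hPI : P ∣ I) : ram P ∧ (Ideal.absNorm P : ℝ) < Z := by
  have hI0 : Ideal.absNorm I ≠ 0 := by rw [Ne, Ideal.absNorm_eq_zero_iff]; exact hI.ne_zero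
  have hle : Ideal.absNorm P ≤ Ideal.absNorm I :=
    Nat.le_of_dvd (Nat.pos_of_ne_zero hI0) (absNorm_dvd hPI)
  have hlt : (Ideal.absNorm P : ℝ) < Z := lt_of_le_of_lt (by exact_mod_cast hle) hIZ
  refine ⟨?_, hlt⟩
  obtain ⟨p, hp, hPp⟩ := exists_prime_below P hP
  rcases prime_struct D p hp with h | ⟨P1, P2, h1, h2, hN1, hN2, h⟩
  · exact absurd (prime_eq_of_dvd hP h hPp ▸ hPI) (hI p hp)
  · have hPN : Ideal.absNorm P = p ∧ ∃ Q, Prime Q ∧ Ideal.span {(p : 𝓞 K)} = P * Q := by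
      have hPp2 := hPp
      rw [h] at hPp2
      rcases hP.dvd_or_dvd hPp2 with h3 | h3
      · rw [prime_eq_of_dvd hP h1 h3]
        exact ⟨hN1, P2, h2, h⟩
      · rw [prime_eq_of_dvd hP h2 h3]
        exact ⟨hN2, P1, h1, by rw [h, mul_comm]⟩
    obtain ⟨hN, Q, hQ, hPQ⟩ := hPN
    have hpZ : (p : ℝ) < Z := by rw [← hN]; exact hlt
    have := no_split D Z hZ hZY p hp hpZ P Q hP hQ hN hPQ
    refine ⟨hP, by rw [hN]; exact hp, ?_⟩
    rw [hN, hPQ, ← this]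

lemma prod_prim (S : Finset (Ideal (𝓞 K))) (hS : ∀ P ∈ S, ram P) : prim (∏ P ∈ S, P) := by
  classical
  intro q hq hdvd
  have htop : Ideal.span {(q : 𝓞 K)} ≠ ⊤ := by
    intro h
    rw [Ideal.span_singleton_eq_top] at h
    have h2 := (Nat.prime_iff_prime_int.1 hq)
    have h4 : IsUnit (Algebra.norm ℤ (q : 𝓞 K)) := h.map _
    have h5 : Algebra.norm ℤ (q : 𝓞 K) = (q : ℤ) ^ Module.finrank ℤ (𝓞 K) := by
      have := Algebra.norm_algebraMap_of_basis (RingOfIntegers.basis K) (q : ℤ)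
      rw [Module.finrank_eq_card_basis (RingOfIntegers.basis K)]
      simpa using this
    have hf : Module.finrank ℤ (𝓞 K) ≠ 0 := by
      rw [RingOfIntegers.rank]; exact Module.finrank_pos.ne'
    rw [h5, isUnit_pow_iff hf] at h4
    exact h2.not_isUnit h4
  obtain ⟨M, hMm, hM⟩ := Ideal.exists_le_maximal _ htop
  have hM0 : M ≠ ⊥ := by
    rintro rfl
    exact span_p_ne q hq (le_bot_iff.1 hM)
  have hMp : Prime M := Ideal.prime_of_isPrime hM0 hMm.isPrime
  have hMq : M ∣ Ideal.span {(q : 𝓞 K)} := Ideal.dvd_iff_le.2 hM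
  obtain ⟨P, hPS, hMP⟩ := (hMp.dvd_finsetProd_iff _).1 (hMq.trans hdvd)
  obtain ⟨hP, hPN, hPP⟩ := hS P hPS
  have hMeq := prime_eq_of_dvd hMp hP hMP
  rw [hMeq] at hMq
  -- q equals the norm of P
  have hqN : ((Ideal.absNorm P : ℕ) : ℤ) ∣ (q : ℤ) :=
    QD.mem_int P hP _ hPN (Ideal.absNorm_mem P) q (by
      have := Ideal.dvd_span_singleton.1 hMq
      simpa using this)
  have hqN2 : Ideal.absNorm P = q := (Nat.prime_dvd_prime_iff_eq hPN hq).1 (by exact_mod_cast hqN)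
  rw [← hqN2, hPP, ← Finset.mul_prod_erase S _ hPS] at hdvd
  have h1 : P ∣ ∏ x ∈ S.erase P, x := (mul_dvd_mul_iff_left hP.ne_zero).1 hdvd
  obtain ⟨P', hP'S, hPP'⟩ := (hP.dvd_finsetProd_iff _).1 h1
  have h2 := Finset.mem_erase.1 hP'S
  exact h2.1 (prime_eq_of_dvd hP (hS P' h2.2).1 hPP').symm

lemma prod_inj (S T : Finset (Ideal (𝓞 K))) (hS : ∀ P ∈ S, ram P) (hT : ∀ P ∈ T, ram P)
    (h : ∏ P ∈ S, P = ∏ P ∈ T, P) : S = T := by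
  have key : ∀ S T : Finset (Ideal (𝓞 K)), (∀ P ∈ S, ram P) → (∀ P ∈ T, ram P) →
      ∏ P ∈ S, P = ∏ P ∈ T, P → S ⊆ T := by
    intro S T hS hT h P hP
    have h1 : P ∣ ∏ P ∈ T, P := by rw [← h]; exact Finset.dvd_prod_of_mem _ hP
    obtain ⟨Q, hQ, hPQ⟩ := ((hS P hP).1.dvd_finsetProd_iff _).1 h1
    rwa [prime_eq_of_dvd (hS P hP).1 (hT Q hQ).1 hPQ]
  exact Finset.Subset.antisymm (key S T hS hT h) (key T S hT hS h.symm)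

lemma small_eq_prod (D : QD K) (Z : ℝ) (hZ : 1 < Z) (hZY : Z ^ (classNumber K + 1) ≤ D.r / 2)
    (I : Ideal (𝓞 K)) (hI : prim I) (hIZ : (Ideal.absNorm I : ℝ) < Z) :
    ∃ S : Finset (Ideal (𝓞 K)), (∀ P ∈ S, ram P ∧ (Ideal.absNorm P : ℝ) < Z) ∧ I = ∏ P ∈ S, P := by
  classical
  have hsq : Squarefree I := by
    intro x hx
    by_contra hu
    have hx0 : x ≠ 0 := by
      rintro rfl
      exact hI.ne_zero (zero_dvd_iff.1 (by simpa only [mul_zero] using hx))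
    obtain ⟨P, hPi, hPx⟩ := WfDvdMonoid.exists_irreducible_factor hu hx0
    have hP : Prime P := hPi.prime
    obtain ⟨⟨-, hN, hPP⟩, -⟩ := small_ram D Z hZ hZY I hI hIZ P hP
      (hPx.trans ((dvd_mul_right x x).trans hx))
    apply hI _ hN
    rw [hPP]
    exact (mul_dvd_mul hPx hPx).trans hx
  have hnd := (UniqueFactorizationMonoid.squarefree_iff_nodup_normalizedFactors hI.ne_zero).1 hsq
  refine ⟨⟨UniqueFactorizationMonoid.normalizedFactors I, hnd⟩, ?_, ?_⟩
  · intro P hP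
    have hP' : P ∈ UniqueFactorizationMonoid.normalizedFactors I := hP
    exact small_ram D Z hZ hZY I hI hIZ P
      (UniqueFactorizationMonoid.prime_of_normalized_factor P hP')
      (UniqueFactorizationMonoid.dvd_of_mem_normalizedFactors hP')
  · conv_lhs => rw [← Ideal.prod_normalizedFactors_eq_self hI.ne_zero]
    simp [Finset.prod]

lemma norm_nat_cpow_le {n : ℕ} (hn : 2 ≤ n) {s : ℂ} (hs : 1 / 2 < s.re) :
    ‖(n : ℂ) ^ (-s)‖ ≤ (2 : ℝ) ^ (-(1 / 2) : ℝ) := by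
  rw [Complex.norm_natCast_cpow_of_pos (by omega)]
  have h1 : (1 : ℝ) ≤ n := by exact_mod_cast (by omega : 1 ≤ n)
  have h2 : (2 : ℝ) ≤ n := by exact_mod_cast hn
  calc (n : ℝ) ^ (-s).re ≤ (n : ℝ) ^ (-(1 / 2) : ℝ) :=
        Real.rpow_le_rpow_of_exponent_le h1 (by simp only [Complex.neg_re]; linarith)
    _ ≤ (2 : ℝ) ^ (-(1 / 2) : ℝ) := Real.rpow_le_rpow_of_nonpos (by norm_num) h2 (by norm_num)

/-- the constant in the lower bound -/
noncomputable def kap : ℝ := 1 - (2 : ℝ) ^ (-(1 / 2) : ℝ)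

lemma kap_pos : 0 < kap := by
  have : (2 : ℝ) ^ (-(1 / 2) : ℝ) < 1 := Real.rpow_lt_one_of_one_lt_of_neg (by norm_num) (by norm_num)
  unfold kap; linarith

lemma kap_le : kap ≤ 1 := by
  have : (0 : ℝ) < (2 : ℝ) ^ (-(1 / 2) : ℝ) := by positivity
  unfold kap; linarith

lemma sum_split_bound {ι : Type*} [Fintype ι] (T : Finset ι) (f : ι → ℂ) (b : ℝ) (hb0 : 0 ≤ b)
    (hb : ∀ c, c ∉ T → ‖f c‖ ≤ b) :
    ‖∑ c ∈ T, f c‖ - Fintype.card ι * b ≤ ‖∑ c, f c‖ := by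
  classical
  have h3 : ‖∑ c ∈ Finset.univ \ T, f c‖ ≤ Fintype.card ι * b := by
    refine (norm_sum_le_of_le _ (fun c hc => hb c (Finset.mem_sdiff.1 hc).2)).trans ?_
    rw [Finset.sum_const, nsmul_eq_mul]
    gcongr
    exact Finset.card_le_univ _
  rw [← Finset.sum_sdiff (Finset.subset_univ T), add_comm]
  have h4 := norm_sub_norm_le (∑ c ∈ T, f c) (-∑ c ∈ Finset.univ \ T, f c)
  rw [norm_neg, sub_neg_eq_add] at h4
  linarith

lemma cl_minI (c : ClassGroup (𝓞 K)) : cl (minI c : Ideal (𝓞 K)) = c :=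
  (dif_pos (minI c).2).trans (minI_mk c)

lemma small_class (D : QD K) (Z : ℝ) (hZ : 1 < Z) (hZY : Z ^ (classNumber K + 1) ≤ D.r / 2)
    (c : ClassGroup (𝓞 K)) (hlt : (nm (minI c) : ℝ) < Z) :
    ∃ S : Finset (Ideal (𝓞 K)), (∀ P ∈ S, ram P ∧ (Ideal.absNorm P : ℝ) < Z) ∧
      cl (∏ P ∈ S, P) = c := by
  obtain ⟨S, hS, hIS⟩ := small_eq_prod D Z hZ hZY (minI c) (minI_prim D c) hlt
  exact ⟨S, hS, (congrArg cl hIS.symm).trans (cl_minI c)⟩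

set_option maxHeartbeats 1000000 in
lemma main_lower (D : QD K) (Z : ℝ) (hZ : 1 < Z) (hZY : Z ^ (classNumber K + 1) ≤ D.r / 2)
    {s : ℂ} (hs : 1 / 2 < s.re) :
    kap ^ classNumber K - classNumber K * Z ^ (-s.re) ≤
      ‖∑ c : ClassGroup (𝓞 K), (nm (minI c) : ℂ) ^ (-s)‖ := by
  classical
  have hZ0 : 0 < Z := by linarith
  have hZ1 : Z ≤ Z ^ (classNumber K + 1) := le_self_pow₀ hZ.le (by omega)
  have hfin : {P : Ideal (𝓞 K) | ram P ∧ (Ideal.absNorm P : ℝ) < Z}.Finite := by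
    refine (Ideal.finite_setOfPred_absNorm_le ⌊Z⌋₊).subset ?_
    rintro P ⟨-, hP⟩
    exact Nat.le_floor hP.le
  set R := hfin.toFinset with hR
  have hmem : ∀ P, P ∈ R ↔ ram P ∧ (Ideal.absNorm P : ℝ) < Z := by
    intro P; rw [hR, Set.Finite.mem_toFinset]; rfl
  have hRc : R.card ≤ classNumber K := by
    apply card_prim D R
    · intro P hP
      have := prod_prim {P} (by
        intro Q hQ
        rw [Finset.mem_singleton.1 hQ]
        exact ((hmem P).1 hP).1)
      simpa using this
    · intro P hP
      have := ((hmem P).1 hP).2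
      linarith
  have hSp : ∀ S ∈ R.powerset, prim (∏ P ∈ S, P) := fun S hS =>
    prod_prim S (fun P hP => ((hmem P).1 (Finset.mem_powerset.1 hS hP)).1)
  have hSn : ∀ S ∈ R.powerset, (Ideal.absNorm (∏ P ∈ S, P) : ℝ) < D.r / 2 := by
    intro S hS
    have hS' := Finset.mem_powerset.1 hS
    rw [map_prod]
    push_cast
    calc ∏ P ∈ S, (Ideal.absNorm P : ℝ) ≤ ∏ P ∈ S, Z :=
          Finset.prod_le_prod (fun _ _ => by positivity) (fun P hP => ((hmem P).1 (hS' hP)).2.le)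
      _ = Z ^ S.card := by rw [Finset.prod_const]
      _ < Z ^ (classNumber K + 1) := by
          apply pow_lt_pow_right₀ hZ
          have := Finset.card_le_card hS'
          omega
      _ ≤ _ := hZY
  have hinj : Set.InjOn (fun S : Finset (Ideal (𝓞 K)) => cl (∏ P ∈ S, P)) (R.powerset : Set _) := by
    intro S hS T hT h
    have hS' := Finset.mem_coe.1 hS
    have hT' := Finset.mem_coe.1 hT
    apply prod_inj S T (fun P hP => ((hmem P).1 (Finset.mem_powerset.1 hS' hP)).1)
      (fun P hP => ((hmem P).1 (Finset.mem_powerset.1 hT' hP)).1)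
    have h' : cl (∏ P ∈ S, P) = cl (∏ P ∈ T, P) := h
    rw [← minI_cl D _ (hSp S hS') (hSn S hS'), ← minI_cl D _ (hSp T hT') (hSn T hT'), h']
  set T := R.powerset.image (fun S : Finset (Ideal (𝓞 K)) => cl (∏ P ∈ S, P)) with hT
  have h1 : ∑ c ∈ T, (nm (minI c) : ℂ) ^ (-s) = ∏ P ∈ R, (1 + (Ideal.absNorm P : ℂ) ^ (-s)) := by
    rw [hT, Finset.sum_image hinj, Finset.prod_one_add]
    apply Finset.sum_congr rfl
    intro S hS
    have : nm (minI (cl (∏ P ∈ S, P))) = Ideal.absNorm (∏ P ∈ S, P) := by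
      unfold nm
      rw [minI_cl D _ (hSp S hS) (hSn S hS)]
    rw [this, map_prod]
    clear this hS
    induction S using Finset.induction_on with
    | empty => simp
    | insert a S ha ih =>
      rw [Finset.prod_insert ha, Finset.prod_insert ha, Nat.cast_mul,
        Complex.natCast_mul_natCast_cpow, ih]
  have h2 : kap ^ classNumber K ≤ ‖∏ P ∈ R, (1 + (Ideal.absNorm P : ℂ) ^ (-s))‖ := by
    rw [norm_prod]
    calc kap ^ classNumber K ≤ kap ^ R.card := pow_le_pow_of_le_one kap_pos.le kap_le hRc
      _ = ∏ P ∈ R, kap := by rw [Finset.prod_const]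
      _ ≤ _ := by
        apply Finset.prod_le_prod (fun _ _ => kap_pos.le)
        intro P hP
        have hp := ((hmem P).1 hP).1.2.1
        have h3 := norm_nat_cpow_le hp.two_le hs
        have h4 := norm_sub_norm_le (1 : ℂ) (-((Ideal.absNorm P : ℂ) ^ (-s)))
        rw [norm_neg, sub_neg_eq_add, norm_one] at h4
        unfold kap
        linarith
  have hb : ∀ c, c ∉ T → ‖(nm (minI c) : ℂ) ^ (-s)‖ ≤ Z ^ (-s.re) := by
    intro c hcT
    have hge : Z ≤ nm (minI c) := by
      by_contra hlt
      obtain ⟨S, hS, hIS⟩ := small_class D Z hZ hZY c (not_le.1 hlt)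
      exact hcT (Finset.mem_image.2
        ⟨S, Finset.mem_powerset.2 (fun P hP => (hmem P).2 (hS P hP)), hIS⟩)
    rw [Complex.norm_natCast_cpow_of_pos (nm_pos _)]
    exact Real.rpow_le_rpow_of_nonpos hZ0 hge (by rw [Complex.neg_re]; linarith)
  have h5 := sum_split_bound T (fun c => (nm (minI c) : ℂ) ^ (-s)) (Z ^ (-s.re)) (by positivity) hb
  rw [h1] at h5
  have h6 : kap ^ classNumber K - classNumber K * Z ^ (-s.re) ≤
      ‖∏ P ∈ R, (1 + (Ideal.absNorm P : ℂ) ^ (-s))‖ - classNumber K * Z ^ (-s.re) :=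
    sub_le_sub_right h2 _
  exact h6.trans h5

end
end Mordell


namespace Mordell
open NumberField

section
variable {K : Type} [Field K] [NumberField K]
open scoped nonZeroDivisors

lemma continuation (f g : ℂ → ℂ)
    (hf : ∀ s : ℂ, 1 / 2 < s.re → s ≠ 1 → DifferentiableAt ℂ f s)
    (hg : ∀ s : ℂ, 1 / 2 < s.re → s ≠ 1 → DifferentiableAt ℂ g s)
    (h : ∀ s : ℂ, 1 < s.re → f s = g s) {ρ : ℂ} (h1 : 1 / 2 < ρ.re) (h2 : ρ.re < 1) :
    f ρ = g ρ := by
  set A : Set ℂ := {s : ℂ | 1 < s.re} with hA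
  set B : Set ℂ := {s : ℂ | 1 / 2 < s.re} ∩ {s : ℂ | 0 < s.im} with hB
  set D : Set ℂ := {s : ℂ | 1 / 2 < s.re} ∩ {s : ℂ | s.re < 1} with hD
  have oA : IsOpen A := isOpen_lt continuous_const Complex.continuous_re
  have oB : IsOpen B := (isOpen_lt continuous_const Complex.continuous_re).inter
    (isOpen_lt continuous_const Complex.continuous_im)
  have oD : IsOpen D := (isOpen_lt continuous_const Complex.continuous_re).inter
    (isOpen_lt Complex.continuous_re continuous_const)
  have cA : IsPreconnected A := (convex_halfSpace_re_gt 1).isPreconnected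
  have cB : IsPreconnected B :=
    ((convex_halfSpace_re_gt (1 / 2)).inter (convex_halfSpace_im_gt 0)).isPreconnected
  have cD : IsPreconnected D :=
    ((convex_halfSpace_re_gt (1 / 2)).inter (convex_halfSpace_re_lt 1)).isPreconnected
  have oU : IsOpen (A ∪ B ∪ D) := (oA.union oB).union oD
  have cAB : IsPreconnected (A ∪ B) :=
    IsPreconnected.union (⟨2, 1⟩ : ℂ) (by simp [hA]) (by rw [hB]; constructor <;> norm_num) cA cB
  have cU : IsPreconnected (A ∪ B ∪ D) :=
    IsPreconnected.union (⟨3 / 4, 1⟩ : ℂ) (Or.inr (by rw [hB]; constructor <;> norm_num))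
      (by rw [hD]; constructor <;> norm_num) cAB cD
  have hU : ∀ s ∈ A ∪ B ∪ D, 1 / 2 < s.re ∧ s ≠ 1 := by
    rintro s ((hs | hs) | hs)
    · have hs' : 1 < s.re := hs
      refine ⟨by linarith, ?_⟩
      rintro rfl
      simp at hs'
    · refine ⟨hs.1, ?_⟩
      rintro rfl
      have : 0 < (1 : ℂ).im := hs.2
      simp at this
    · refine ⟨hs.1, ?_⟩
      rintro rfl
      have : (1 : ℂ).re < 1 := hs.2
      simp at this
  have aF : AnalyticOnNhd ℂ f (A ∪ B ∪ D) := DifferentiableOn.analyticOnNhd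
    (fun s hs => (hf s (hU s hs).1 (hU s hs).2).differentiableWithinAt) oU
  have aG : AnalyticOnNhd ℂ g (A ∪ B ∪ D) := DifferentiableOn.analyticOnNhd
    (fun s hs => (hg s (hU s hs).1 (hU s hs).2).differentiableWithinAt) oU
  have h2A : (2 : ℂ) ∈ A := by simp [hA]
  refine aF.eqOn_of_preconnected_of_eventuallyEq aG cU (z₀ := 2) (Or.inl (Or.inl h2A)) ?_
    (Or.inr ⟨h1, h2⟩)
  filter_upwards [oA.mem_nhds h2A] with s hs
  exact h s hs

lemma zero_relation (D : QD K) (hd : D.d < -4) {ρ : ℂ} (h0 : riemannZeta ρ = 0)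
    (h1 : 1 / 2 < ρ.re) (h2 : ρ.re < 1) :
    2 * ‖riemannZeta (2 * ρ)‖ * ‖∑ c : ClassGroup (𝓞 K), (nm (minI c) : ℂ) ^ (-ρ)‖ ≤
      classNumber K * (Crem ρ * (D.r / 2) ^ (1 - 2 * ρ.re)) := by
  obtain ⟨u, y, huy, hS⟩ := QD.zetaK_hasSum D hd
  obtain ⟨M, hM, hS2⟩ := zetaK_factor D hd
  have key := continuation (fun s => riemannZeta s * M s)
    (fun s => (∑ c, (nm (minI c) : ℂ) ^ (-s) * (2 * riemannZeta (2 * s) + Grem (u c) (y c) s)) / 2)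
    (fun s hs hs1 => (differentiableAt_riemannZeta hs1).mul (hM s hs hs1))
    (fun s hs hs1 => by
      apply DifferentiableAt.div_const
      apply DifferentiableAt.fun_sum
      intro c _
      have hc : (nm (minI c) : ℂ) ≠ 0 := by exact_mod_cast (nm_pos (minI c)).ne'
      apply DifferentiableAt.mul
      · exact (differentiableAt_id.neg).const_cpow (Or.inl hc)
      · apply DifferentiableAt.add
        · apply DifferentiableAt.const_mul
          have h3 : (2 * s) ≠ 1 := by
            intro h
            have := congrArg Complex.re h
            simp at this
            linarith
          exact DifferentiableAt.comp s (differentiableAt_riemannZeta h3)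
            (differentiableAt_id.const_mul 2)
        · exact Grem_diff (by linarith [(huy c).1]) (u c) hs hs1)
    (fun s hs => (hS2 s hs).unique (hS s hs)) h1 h2
  simp only [h0, zero_mul] at key
  have hr : 0 < D.r / 2 := by have := D.r_pos; positivity
  have e : 2 * riemannZeta (2 * ρ) * ∑ c : ClassGroup (𝓞 K), (nm (minI c) : ℂ) ^ (-ρ) =
      -∑ c, (nm (minI c) : ℂ) ^ (-ρ) * Grem (u c) (y c) ρ := by
    have h3 : (∑ c, (nm (minI c) : ℂ) ^ (-ρ) *
        (2 * riemannZeta (2 * ρ) + Grem (u c) (y c) ρ)) = 0 := by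
      have := key.symm
      simpa using this
    simp only [mul_add, Finset.sum_add_distrib] at h3
    rw [← Finset.sum_mul] at h3
    linear_combination h3
  have hb : ∀ c ∈ (Finset.univ : Finset (ClassGroup (𝓞 K))),
      ‖(nm (minI c) : ℂ) ^ (-ρ) * Grem (u c) (y c) ρ‖ ≤
        Crem ρ * (D.r / 2) ^ (1 - 2 * ρ.re) := by
    intro c _
    have hn := nm_pos (minI c)
    have hn1 : (1 : ℝ) ≤ nm (minI c) := by exact_mod_cast hn
    have hy : 0 < y c := by linarith [(huy c).1]
    rw [norm_mul, Complex.norm_natCast_cpow_of_pos hn]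
    calc (nm (minI c) : ℝ) ^ (-ρ).re * ‖Grem (u c) (y c) ρ‖
        ≤ (nm (minI c) : ℝ) ^ (1 - 2 * ρ.re) * (Crem ρ * (y c) ^ (1 - 2 * ρ.re)) := by
          apply mul_le_mul _ (Grem_le (huy c).1 (u c) h1) (norm_nonneg _) (by positivity)
          apply Real.rpow_le_rpow_of_exponent_le hn1
          rw [Complex.neg_re]; linarith
      _ = Crem ρ * (nm (minI c) * y c) ^ (1 - 2 * ρ.re) := by
          rw [Real.mul_rpow (by positivity) hy.le]; ring
      _ ≤ _ := by
          apply mul_le_mul_of_nonneg_left _ (Crem_nonneg ρ)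
          exact Real.rpow_le_rpow_of_nonpos hr (huy c).2 (by linarith)
  have h4 := congrArg norm e
  rw [norm_mul, norm_mul, norm_neg, Complex.norm_two] at h4
  rw [h4]
  refine (norm_sum_le_of_le _ hb).trans ?_
  rw [Finset.sum_const, nsmul_eq_mul]
  exact le_of_eq rfl

/-- for a zero off the line, class number `h` bounds the discriminant -/
lemma exists_bound {ρ : ℂ} (h0 : riemannZeta ρ = 0) (h1 : 1 / 2 < ρ.re) (h2 : ρ.re < 1) (h : ℕ) :
    ∃ Y0 : ℝ, ∀ (K : Type) [Field K] [NumberField K] (D : QD K), D.d < -4 → classNumber K = h →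
      D.r / 2 < Y0 := by
  have hz : riemannZeta (2 * ρ) ≠ 0 := riemannZeta_ne_zero_of_one_le_re (by simp; linarith)
  have hz' : 0 < ‖riemannZeta (2 * ρ)‖ := norm_pos_iff.2 hz
  have t1 : Filter.Tendsto (fun Y : ℝ => Y ^ ((1 : ℝ) / (h + 1))) Filter.atTop Filter.atTop :=
    tendsto_rpow_atTop (by positivity)
  have t2 : Filter.Tendsto (fun Y : ℝ => (Y ^ ((1 : ℝ) / (h + 1))) ^ (-ρ.re)) Filter.atTop
      (nhds 0) := (tendsto_rpow_neg_atTop (by linarith)).comp t1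
  have t3 : Filter.Tendsto (fun Y : ℝ => Y ^ (1 - 2 * ρ.re)) Filter.atTop (nhds 0) := by
    have := tendsto_rpow_neg_atTop (y := 2 * ρ.re - 1) (by linarith)
    simpa using this
  have t4 : Filter.Tendsto (fun Y : ℝ => 2 * ‖riemannZeta (2 * ρ)‖ *
      (h * (Y ^ ((1 : ℝ) / (h + 1))) ^ (-ρ.re)) + h * (Crem ρ * Y ^ (1 - 2 * ρ.re)))
      Filter.atTop (nhds 0) := by
    have := ((t2.const_mul (h : ℝ)).const_mul (2 * ‖riemannZeta (2 * ρ)‖)).add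
      ((t3.const_mul (Crem ρ)).const_mul (h : ℝ))
    simpa using this
  have hk : 0 < 2 * ‖riemannZeta (2 * ρ)‖ * kap ^ h := by
    have := kap_pos
    positivity
  have ev := (t4.eventually (gt_mem_nhds hk)).and (Filter.eventually_gt_atTop (1 : ℝ))
  obtain ⟨Y0, hY0⟩ := Filter.eventually_atTop.1 ev
  refine ⟨Y0, fun K _ _ D hd hK => ?_⟩
  by_contra hlt
  obtain ⟨hY, hY1⟩ := hY0 (D.r / 2) (not_lt.1 hlt)
  have a1 := zero_relation D hd h0 h1 h2
  have hexp : ((D.r / 2) ^ ((1 : ℝ) / (h + 1))) ^ (h + 1) = D.r / 2 := by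
    rw [← Real.rpow_natCast, ← Real.rpow_mul (by linarith)]
    push_cast
    rw [one_div, inv_mul_cancel₀ (by positivity), Real.rpow_one]
  have a2 := main_lower D ((D.r / 2) ^ ((1 : ℝ) / (h + 1)))
    (Real.one_lt_rpow hY1 (by positivity)) (by rw [hK, hexp]) h1
  rw [hK] at a1 a2
  have a3 := mul_le_mul_of_nonneg_left a2 (by positivity : 0 ≤ 2 * ‖riemannZeta (2 * ρ)‖)
  rw [mul_sub] at a3
  linarith

end

lemma exists_field (d : ℤ) (hd : d < 0) : ∃ (K : Type) (_ : Field K) (_ : NumberField K),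
    Module.finrank ℚ K = 2 ∧ ∃ α : K, α ^ 2 = (d : K) := by
  have : Fact (∀ r : ℚ, r ^ 2 ≠ (d : ℚ) + 0 * r) := ⟨fun r h => by
    have h1 : (d : ℚ) < 0 := by exact_mod_cast hd
    nlinarith [sq_nonneg r]⟩
  have hfin : Module.finrank ℚ (QuadraticAlgebra ℚ (d : ℚ) 0) = 2 :=
    QuadraticAlgebra.finrank_eq_two _ _
  have hfd : FiniteDimensional ℚ (QuadraticAlgebra ℚ (d : ℚ) 0) := inferInstance
  refine ⟨QuadraticAlgebra ℚ (d : ℚ) 0, inferInstance, ?_, ?_, ⟨0, 1⟩, ?_⟩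
  · refine @NumberField.mk _ _ inferInstance ?_
    convert hfd
  · convert hfin
  · rw [pow_two]
    ext <;> simp

lemma no_zero (h₀ : ℕ) (hinf : {d : ℤ | d < 0 ∧ Squarefree d ∧
        ∀ (K : Type) [Field K] [NumberField K], Module.finrank ℚ K = 2 →
          (∃ α : K, α ^ 2 = (d : K)) → NumberField.classNumber K = h₀}.Infinite)
    {ρ : ℂ} (h0 : riemannZeta ρ = 0) (h1 : 1 / 2 < ρ.re) (h2 : ρ.re < 1) : False := by
  obtain ⟨Y0, hY0⟩ := exists_bound h0 h1 h2 h₀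
  apply hinf
  refine (Set.finite_Icc (-(⌈4 * Y0 ^ 2⌉ + 4)) (0 : ℤ)).subset ?_
  rintro d ⟨hd, hsq, hK⟩
  refine ⟨?_, hd.le⟩
  by_contra hlt
  push Not at hlt
  obtain ⟨K, i1, i2, hf, hα⟩ := exists_field d hd
  obtain ⟨D, hD⟩ := exists_QD d hd hsq hf hα
  have hc0 : (0 : ℤ) ≤ ⌈4 * Y0 ^ 2⌉ := Int.ceil_nonneg (by positivity)
  have h3 := hY0 K D (by rw [hD]; omega) (hK K hf hα)
  have h4 := D.r_sq
  have h5 := D.r_pos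
  have h6 : (4 * Y0 ^ 2 : ℝ) ≤ ⌈4 * Y0 ^ 2⌉ := Int.le_ceil _
  have h7 : (d : ℝ) < -(⌈4 * Y0 ^ 2⌉ + 4) := by exact_mod_cast hlt
  rw [hD] at h4
  nlinarith

end Mordell

theorem mordell_bounded_class_number_implies_RH
    (h : ∃ h₀ : ℕ, 0 < h₀ ∧ {d : ℤ | d < 0 ∧ Squarefree d ∧
        ∀ (K : Type) [Field K] [NumberField K], Module.finrank ℚ K = 2 →
          (∃ α : K, α ^ 2 = (d : K)) → NumberField.classNumber K = h₀}.Infinite) :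
    ∀ ρ : ℂ, riemannZeta ρ = 0 → 0 < ρ.re → ρ.re < 1 → ρ.re = 1 / 2 := by
  obtain ⟨h₀, -, hinf⟩ := h
  intro ρ h0 hpos hlt
  by_contra hne
  rcases lt_or_gt_of_ne hne with h1 | h1
  · have hz : riemannZeta (1 - ρ) = 0 := by
      rw [riemannZeta_one_sub, h0, mul_zero]
      · intro n hn
        rw [hn] at hpos
        simp at hpos
        have : (0 : ℝ) ≤ n := by positivity
        linarith
      · rintro rfl
        simp at hlt
    exact Mordell.no_zero h₀ hinf hz (by simp; linarith) (by simp; linarith)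
  · exact Mordell.no_zero h₀ hinf h0 h1 hlt
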